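/- arXiv:1202.6035 — 3 statements merged into one kernel-verified Lean document; each statement's English description precedes it below -/
import Mathlib

section
/- Let f^G : {0,1}^n → ℝ≥0 admit a factorization f^G(x) = ∏_{i∈V} φ_i(x_i) · ∏_{α∈𝒜} ψ_α(x_α) over G = (V, 𝒜) in which every ψ_α is log-supermodular, and let f^H be the function associated to a permutation-encoded k-cover H of G. Then Z(H) ≤ Z(G)^k, i.e. ∑_{x^1,…,x^k ∈ {0,1}^n} f^H(x^1,…,x^k) ≤ ( ∑_{x ∈ {0,1}^n} f^G(x) )^k. -/
open scoped NNReal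

/-- number of `true` entries -/
def cnt {k : ℕ} (s : Fin k → Bool) : ℕ := ∑ a, (s a).toNat

lemma cnt_inf_sup {k : ℕ} (s t : Fin k → Bool) : cnt (s ⊓ t) + cnt (s ⊔ t) = cnt s + cnt t := by
  unfold cnt
  rw [← Finset.sum_add_distrib, ← Finset.sum_add_distrib]
  refine Finset.sum_congr rfl fun i _ => ?_
  simp only [Pi.inf_apply, Pi.sup_apply]
  cases s i <;> cases t i <;> rfl

lemma cnt_mono {k : ℕ} {s t : Fin k → Bool} (h : s ≤ t) : cnt s ≤ cnt t := by
  unfold cnt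
  refine Finset.sum_le_sum fun i _ => ?_
  have aux : ∀ p q : Bool, p ≤ q → p.toNat ≤ q.toNat := by decide
  exact aux _ _ (h i)

lemma cnt_le {k : ℕ} (s : Fin k → Bool) : cnt s ≤ k := by
  unfold cnt
  calc _ ≤ ∑ _a : Fin k, 1 := Finset.sum_le_sum fun i _ => by cases s i <;> decide
    _ = k := by simp

lemma cnt_cons {k : ℕ} (b : Bool) (s : Fin k → Bool) :
    cnt (Fin.cons b s : Fin (k+1) → Bool) = b.toNat + cnt s := by
  unfold cnt
  rw [Fin.sum_univ_succ]
  simp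

lemma cnt_perm {k : ℕ} (s : Fin k → Bool) (σ : Equiv.Perm (Fin k)) :
    cnt (fun a => s (σ a)) = cnt s := by
  unfold cnt
  exact Equiv.sum_comp σ (fun a => (s a).toNat)

lemma cons_inf {n : ℕ} {L : Type*} [Lattice L] (a b : L) (s t : Fin n → L) :
    (Fin.cons a s : Fin (n+1) → L) ⊓ Fin.cons b t = Fin.cons (a ⊓ b) (s ⊓ t) := by
  funext i
  refine Fin.cases ?_ (fun j => ?_) i <;> simp

lemma cons_sup {n : ℕ} {L : Type*} [Lattice L] (a b : L) (s t : Fin n → L) :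
    (Fin.cons a s : Fin (n+1) → L) ⊔ Fin.cons b t = Fin.cons (a ⊔ b) (s ⊔ t) := by
  funext i
  refine Fin.cases ?_ (fun j => ?_) i <;> simp

lemma sum_cons {n : ℕ} {L M : Type*} [Fintype L] [DecidableEq L] [AddCommMonoid M]
    (g : (Fin (n+1) → L) → M) :
    ∑ s, g s = ∑ t : Fin n → L, ∑ b : L, g (Fin.cons b t) := by
  rw [← (Fin.consEquiv (fun _ : Fin (n+1) => L)).sum_comp, Fintype.sum_prod_type,
    Finset.sum_comm]
  rfl

/-- the numerical inequality for the modified sequence -/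
lemma seq_ineq (r : ℕ → ℝ) (ρ : ℝ) (hρ : 0 < ρ) (hr : ∀ i, 0 < r i) (k : ℕ) :
    (min (r 0) ρ / ρ) * (∏ i ∈ Finset.range k, (1 + max (r i) ρ * min (r (i+1)) ρ / ρ))
      * (1 + max (r k) ρ) ≤ ∏ i ∈ Finset.range (k+1), (1 + r i) := by
  induction k with
  | zero =>
    simp only [Finset.range_zero, Finset.prod_empty, mul_one, zero_add, Finset.prod_range_one]
    rcases le_total (r 0) ρ with h | h
    · rw [min_eq_left h, max_eq_right h, div_mul_eq_mul_div, div_le_iff₀ hρ]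
      nlinarith
    · rw [min_eq_right h, max_eq_left h, div_self hρ.ne', one_mul]
  | succ k ih =>
    rw [Finset.prod_range_succ, Finset.prod_range_succ (fun i => 1 + r i) (k+1)]
    set P := ∏ i ∈ Finset.range k, (1 + max (r i) ρ * min (r (i+1)) ρ / ρ) with hP
    have hP0 : 0 ≤ P := Finset.prod_nonneg fun i _ => by
      have := hr i
      have := hr (i+1)
      positivity
    have hm : 0 ≤ min (r 0) ρ / ρ := by
      have := hr 0
      positivity
    have key : (1 + max (r k) ρ * min (r (k+1)) ρ / ρ) * (1 + max (r (k+1)) ρ)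
        ≤ (1 + max (r k) ρ) * (1 + r (k+1)) := by
      have hM : ρ ≤ max (r k) ρ := le_max_right _ _
      generalize max (r k) ρ = M at hM
      rcases le_total (r (k+1)) ρ with h | h
      · rw [min_eq_left h, max_eq_right h]
        have e : (1 + M * r (k+1) / ρ) * (1 + ρ) = 1 + ρ + M * r (k+1) + M * r (k+1) / ρ := by
          field_simp
          ring
        have : M * r (k+1) / ρ ≤ M + r (k+1) - ρ := by
          rw [div_le_iff₀ hρ]
          nlinarith
        rw [e]
        nlinarith
      · rw [min_eq_right h, max_eq_left h, mul_div_assoc, div_self hρ.ne', mul_one]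
    have hk1 := hr (k+1)
    calc _ = (min (r 0) ρ / ρ * P) *
          ((1 + max (r k) ρ * min (r (k+1)) ρ / ρ) * (1 + max (r (k+1)) ρ)) := by ring
      _ ≤ (min (r 0) ρ / ρ * P) * ((1 + max (r k) ρ) * (1 + r (k+1))) :=
          mul_le_mul_of_nonneg_left key (mul_nonneg hm hP0)
      _ = (min (r 0) ρ / ρ * P * (1 + max (r k) ρ)) * (1 + r (k+1)) := by ring
      _ ≤ _ := mul_le_mul_of_nonneg_right ih (by linarith)

lemma seq_prod (r : ℕ → ℝ) (ρ : ℝ) (hρ : 0 < ρ) (m : ℕ) :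
    (min (r 0) ρ / ρ) * (∏ i ∈ Finset.range m, (max (r i) ρ * min (r (i+1)) ρ / ρ))
      = (∏ i ∈ Finset.range m, r i) * (min (r m) ρ / ρ) := by
  induction m with
  | zero => simp
  | succ m ih =>
    rw [Finset.prod_range_succ, Finset.prod_range_succ, ← mul_assoc, ih]
    have : min (r m) ρ * max (r m) ρ = r m * ρ := min_mul_max _ _
    calc _ = (∏ i ∈ Finset.range m, r i) * (min (r m) ρ * max (r m) ρ) * min (r (m+1)) ρ / ρ / ρ := by
          ring
      _ = _ := by
          rw [this]
          field_simp

/-- log-concavity of the partial products -/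
lemma logconc (r : ℕ → ℝ) (hr : ∀ i, 0 < r i) (ha : Antitone r) (p a b q : ℕ)
    (hpa : p ≤ a) (hpb : p ≤ b) (h : p + q = a + b) :
    (∏ i ∈ Finset.range p, r i) * (∏ i ∈ Finset.range q, r i)
      ≤ (∏ i ∈ Finset.range a, r i) * (∏ i ∈ Finset.range b, r i) := by
  obtain ⟨d, rfl⟩ := Nat.exists_eq_add_of_le hpa
  obtain rfl : q = b + d := by omega
  rw [Finset.prod_range_add, Finset.prod_range_add]
  have h1 : ∏ i ∈ Finset.range d, r (b + i) ≤ ∏ i ∈ Finset.range d, r (p + i) :=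
    Finset.prod_le_prod (fun i _ => (hr _).le) (fun i _ => ha (by omega))
  have hp : 0 < ∏ i ∈ Finset.range p, r i := Finset.prod_pos fun i _ => hr i
  have hb : 0 < ∏ i ∈ Finset.range b, r i := Finset.prod_pos fun i _ => hr i
  have := mul_le_mul_of_nonneg_left h1 (mul_pos hp hb).le
  linarith

lemma oneD (k : ℕ) : ∀ (g : (Fin k → Bool) → ℝ) (r : ℕ → ℝ) (c : ℝ), 0 < c → (∀ i, 0 < r i) →
    Antitone r → (∀ s, 0 ≤ g s) → (∀ s t, g s * g t ≤ g (s ⊓ t) * g (s ⊔ t)) →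
    (∀ s, g s ≤ c * ∏ i ∈ Finset.range (cnt s), r i) →
    ∑ s, g s ≤ c * ∏ i ∈ Finset.range k, (1 + r i) := by
  induction k with
  | zero =>
    intro g r c hc hr ha hg hs hb
    have := hb default
    rw [Fintype.sum_unique]
    have e : cnt (default : Fin 0 → Bool) = 0 := rfl
    rw [e] at this
    simp only [Finset.range_zero, Finset.prod_empty] at this ⊢
    convert this using 2
  | succ k ih =>
    intro g r c hc hr ha hg hs hb
    set h : ℕ → ℝ := fun m => c * ∏ i ∈ Finset.range m, r i with hh
    have hpos : ∀ m, 0 < h m := fun m => mul_pos hc (Finset.prod_pos fun i _ => hr i)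
    have hsucc : ∀ m, h (m+1) = h m * r m := fun m => by
      simp only [hh, Finset.prod_range_succ, mul_assoc]
    have hb0 : ∀ T : Fin k → Bool, g (Fin.cons false T) ≤ h (cnt T) := fun T => by
      have := hb (Fin.cons false T)
      rw [cnt_cons] at this
      simpa using this
    have hb1 : ∀ T : Fin k → Bool, g (Fin.cons true T) ≤ h (cnt T + 1) := fun T => by
      have := hb (Fin.cons true T)
      rw [cnt_cons, add_comm true.toNat] at this
      simpa using this
    have cross : ∀ T T' : Fin k → Bool,
        g (Fin.cons true T) * g (Fin.cons false T') ≤ h (cnt T) * h (cnt T' + 1) := by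
      intro T T'
      have h1 := hs (Fin.cons true T) (Fin.cons false T')
      rw [cons_inf, cons_sup] at h1
      have h2 : g (Fin.cons (true ⊓ false) (T ⊓ T')) * g (Fin.cons (true ⊔ false) (T ⊔ T'))
          ≤ h (cnt (T ⊓ T')) * h (cnt (T ⊔ T') + 1) :=
        mul_le_mul (hb0 _) (hb1 _) (hg _) (hpos _).le
      refine h1.trans (h2.trans ?_)
      have h3 := logconc r hr ha (cnt (T ⊓ T')) (cnt T) (cnt T' + 1) (cnt (T ⊔ T') + 1)
        (cnt_mono inf_le_left) ((cnt_mono inf_le_right).trans (Nat.le_succ _))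
        (by have := cnt_inf_sup T T'; omega)
      have := mul_le_mul_of_nonneg_left h3 (mul_pos hc hc).le
      simp only [hh]
      linarith
    obtain ⟨ρ, hρ, hρ1, hρ2⟩ : ∃ ρ : ℝ, 0 < ρ ∧
        (∀ T : Fin k → Bool, g (Fin.cons true T) ≤ ρ * h (cnt T)) ∧
        (∀ T : Fin k → Bool, ρ * g (Fin.cons false T) ≤ h (cnt T + 1)) := by
      obtain ⟨T0, hT0⟩ := Finite.exists_max
        (fun T : Fin k → Bool => g (Fin.cons true T) / h (cnt T))
      refine ⟨max (g (Fin.cons true T0) / h (cnt T0)) (r k), lt_max_of_lt_right (hr k), ?_, ?_⟩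
      · intro T
        rw [← div_le_iff₀ (hpos _)]
        exact (hT0 T).trans (le_max_left _ _)
      · intro T
        rw [max_mul_of_nonneg _ _ (hg _)]
        refine max_le ?_ ?_
        · rw [div_mul_eq_mul_div, div_le_iff₀ (hpos _)]
          have := cross T0 T
          linarith
        · rw [hsucc, mul_comm]
          exact mul_le_mul (hb0 T) (ha (cnt_le T)) (hr _).le (hpos _).le
    set g1 : (Fin k → Bool) → ℝ :=
      fun T => max (g (Fin.cons false T)) (g (Fin.cons true T) / ρ) with hg1
    set r' : ℕ → ℝ := fun i => max (r i) ρ * min (r (i+1)) ρ / ρ with hr'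
    have main := ih g1 r' (c * (min (r 0) ρ / ρ))
      (mul_pos hc (div_pos (lt_min (hr 0) hρ) hρ))
      (fun i => div_pos (mul_pos (lt_max_of_lt_right hρ) (lt_min (hr _) hρ)) hρ)
      (fun i j hij => by
        simp only [hr']
        refine div_le_div_of_nonneg_right ?_ hρ.le
        exact mul_le_mul (max_le_max_right _ (ha hij)) (min_le_min_right _ (ha (by omega)))
          (lt_min (hr _) hρ).le (lt_max_of_lt_right hρ).le)
      (fun s => le_max_of_le_left (hg _))
      (by
        intro s t
        have l0 : ∀ T, g (Fin.cons false T) ≤ g1 T := fun T => le_max_left _ _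
        have l1 : ∀ T, g (Fin.cons true T) ≤ ρ * g1 T := fun T => by
          rw [mul_comm, ← div_le_iff₀ hρ]
          exact le_max_right _ _
        have n1 : ∀ T, 0 ≤ g1 T := fun T => le_max_of_le_left (hg _)
        have e00 := hs (Fin.cons false s) (Fin.cons false t)
        have e01 := hs (Fin.cons false s) (Fin.cons true t)
        have e10 := hs (Fin.cons true s) (Fin.cons false t)
        have e11 := hs (Fin.cons true s) (Fin.cons true t)
        rw [cons_inf, cons_sup] at e00 e01 e10 e11
        have f00 := e00.trans (mul_le_mul (l0 (s ⊓ t)) (l0 (s ⊔ t)) (hg _) (n1 _))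
        have f01 := e01.trans (mul_le_mul (l0 (s ⊓ t)) (l1 (s ⊔ t)) (hg _) (n1 _))
        have f10 := e10.trans (mul_le_mul (l0 (s ⊓ t)) (l1 (s ⊔ t)) (hg _) (n1 _))
        have f11 := e11.trans (mul_le_mul (l1 (s ⊓ t)) (l1 (s ⊔ t)) (hg _)
          (mul_nonneg hρ.le (n1 _)))
        have c1 : g1 s = g (Fin.cons false s) ∨ g1 s = g (Fin.cons true s) / ρ := max_choice _ _
        have c2 : g1 t = g (Fin.cons false t) ∨ g1 t = g (Fin.cons true t) / ρ := max_choice _ _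
        rcases c1 with c1 | c1 <;> rcases c2 with c2 | c2 <;> rw [c1, c2]
        · exact f00
        · rw [mul_div_assoc', div_le_iff₀ hρ]
          linarith
        · rw [div_mul_eq_mul_div, div_le_iff₀ hρ]
          linarith
        · rw [div_mul_div_comm, div_le_iff₀ (mul_pos hρ hρ)]
          linarith)
      (by
        intro s
        rw [mul_assoc, seq_prod r ρ hρ, ← mul_assoc]
        change g1 s ≤ h (cnt s) * _
        have a0 := hb0 s
        have a1 := hb1 s
        have a2 := hρ1 s
        have a3 := hρ2 s
        rw [hsucc] at a1 a3
        rcases le_total (r (cnt s)) ρ with hc | hc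
        · rw [min_eq_left hc, mul_div_assoc']
          refine max_le ?_ ?_
          · rw [le_div_iff₀ hρ]
            linarith
          · exact div_le_div_of_nonneg_right a1 hρ.le
        · rw [min_eq_right hc, div_self hρ.ne', mul_one]
          refine max_le a0 ?_
          rw [div_le_iff₀ hρ]
          linarith)
    have fin := seq_ineq r ρ hρ hr k
    have step : ∑ s, g s ≤ (1 + ρ) * ∑ T, g1 T := by
      rw [sum_cons, Finset.mul_sum]
      refine Finset.sum_le_sum fun T _ => ?_
      rw [Fintype.sum_bool]
      have l0 : g (Fin.cons false T) ≤ g1 T := le_max_left _ _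
      have l1 : g (Fin.cons true T) ≤ ρ * g1 T := by
        rw [mul_comm, ← div_le_iff₀ hρ]
        exact le_max_right _ _
      linarith
    refine step.trans ?_
    have hP0 : 0 ≤ ∏ i ∈ Finset.range k, (1 + r' i) := Finset.prod_nonneg fun i _ => by
      have : 0 < r' i :=
        div_pos (mul_pos (lt_max_of_lt_right hρ) (lt_min (hr _) hρ)) hρ
      linarith
    have hm0 : 0 < min (r 0) ρ / ρ := div_pos (lt_min (hr 0) hρ) hρ
    calc (1 + ρ) * ∑ T, g1 T
        ≤ (1 + ρ) * (c * (min (r 0) ρ / ρ) * ∏ i ∈ Finset.range k, (1 + r' i)) :=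
          mul_le_mul_of_nonneg_left main (by linarith)
      _ = c * ((min (r 0) ρ / ρ * ∏ i ∈ Finset.range k, (1 + r' i)) * (1 + ρ)) := by ring
      _ ≤ c * ((min (r 0) ρ / ρ * ∏ i ∈ Finset.range k, (1 + r' i)) * (1 + max (r k) ρ)) := by
          refine mul_le_mul_of_nonneg_left ?_ hc.le
          refine mul_le_mul_of_nonneg_left ?_ (mul_nonneg hm0.le hP0)
          have := le_max_right (r k) ρ
          linarith
      _ ≤ _ := mul_le_mul_of_nonneg_left fin hc.le

/-- positive version with pairs -/
lemma oneD_pos (k : ℕ) (hk : 1 ≤ k) (g : (Fin k → Bool) → ℝ) (A B : ℕ → ℝ)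
    (hA : ∀ a < k, 0 < A a) (hB : ∀ a < k, 0 < B a)
    (hAB : ∀ a b, a ≤ b → A b * B a ≤ A a * B b)
    (hg : ∀ s, 0 ≤ g s) (hs : ∀ s t, g s * g t ≤ g (s ⊓ t) * g (s ⊔ t))
    (hb : ∀ s, g s ≤ ∏ a ∈ Finset.range k, if a < cnt s then A a else B a) :
    ∑ s, g s ≤ ∏ a ∈ Finset.range k, (A a + B a) := by
  have hlt : ∀ a, min a (k-1) < k := fun a => by omega
  set r : ℕ → ℝ := fun a => A (min a (k-1)) / B (min a (k-1)) with hr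
  have hra : ∀ a < k, r a = A a / B a := fun a ha => by
    simp only [hr]
    rw [min_eq_left (by omega)]
  have := oneD k g r (∏ a ∈ Finset.range k, B a)
    (Finset.prod_pos fun a ha => hB a (Finset.mem_range.1 ha))
    (fun i => div_pos (hA _ (hlt i)) (hB _ (hlt i)))
    (fun i j hij => by
      simp only [hr]
      rw [div_le_div_iff₀ (hB _ (hlt _)) (hB _ (hlt _))]
      exact hAB _ _ (by omega))
    hg hs
    (fun s => by
      refine (hb s).trans (le_of_eq ?_)
      have e : ∏ i ∈ Finset.range (cnt s), r i
          = ∏ i ∈ Finset.range k, if i < cnt s then r i else 1 := by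
        rw [← Finset.prod_filter]
        refine Finset.prod_congr ?_ fun _ _ => rfl
        ext i
        have := cnt_le s
        simp only [Finset.mem_range, Finset.mem_filter]
        omega
      rw [e, ← Finset.prod_mul_distrib]
      refine Finset.prod_congr rfl fun i hi => ?_
      have hi := Finset.mem_range.1 hi
      split_ifs
      · rw [hra i hi]
        have := (hB i hi).ne'
        field_simp
      · ring)
  refine this.trans (le_of_eq ?_)
  rw [← Finset.prod_mul_distrib]
  refine Finset.prod_congr rfl fun i hi => ?_
  have hi := Finset.mem_range.1 hi
  rw [hra i hi]
  have := (hB i hi).ne'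
  field_simp
  ring

lemma oneD_nonneg (k : ℕ) (hk : 1 ≤ k) (g : (Fin k → Bool) → ℝ) (A B : ℕ → ℝ)
    (hA : ∀ a, 0 ≤ A a) (hB : ∀ a, 0 ≤ B a)
    (hAB : ∀ a b, a ≤ b → A b * B a ≤ A a * B b)
    (hg : ∀ s, 0 ≤ g s) (hs : ∀ s t, g s * g t ≤ g (s ⊓ t) * g (s ⊔ t))
    (hb : ∀ s, g s ≤ ∏ a ∈ Finset.range k, if a < cnt s then A a else B a) :
    ∑ s, g s ≤ ∏ a ∈ Finset.range k, (A a + B a) := by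
  by_cases hz : ∃ a < k, A a = 0 ∧ B a = 0
  · obtain ⟨a, ha, h1, h2⟩ := hz
    have h0 : ∀ s, g s ≤ 0 := fun s => by
      refine (hb s).trans (le_of_eq ?_)
      refine Finset.prod_eq_zero (Finset.mem_range.2 ha) ?_
      simp [h1, h2]
    exact (Finset.sum_nonpos fun s _ => h0 s).trans
      (Finset.prod_nonneg fun i _ => add_nonneg (hA i) (hB i))
  have key : ∀ ε : ℝ, 0 < ε → ε < 1 →
      ∑ s, g s ≤ (1 + ε) ^ k * ∏ a ∈ Finset.range k, (A a + B a) := by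
    intro ε h0 h1
    have hne : ∀ a < k, 0 < A a ∨ 0 < B a := fun a ha => by
      by_contra hcon
      push Not at hcon
      exact hz ⟨a, ha, le_antisymm hcon.1 (hA a), le_antisymm hcon.2 (hB a)⟩
    have := oneD_pos k hk g (fun a => A a + ε * B a) (fun a => B a + ε * A a)
      (fun a ha => by
        have := hA a
        have := hB a
        rcases hne a ha with h | h <;> positivity)
      (fun a ha => by
        have := hA a
        have := hB a
        rcases hne a ha with h | h <;> positivity)
      (fun a b hab => by
        have h2 := hAB a b hab
        have : 0 ≤ (1 - ε ^ 2) * (A a * B b - A b * B a) :=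
          mul_nonneg (by nlinarith) (by linarith)
        linarith)
      hg hs
      (fun s => (hb s).trans (Finset.prod_le_prod
        (fun a _ => by split_ifs; exacts [hA a, hB a])
        (fun a _ => by
          have := mul_nonneg h0.le (hA a)
          have := mul_nonneg h0.le (hB a)
          split_ifs <;> linarith)))
    refine this.trans (le_of_eq ?_)
    have e : (1 + ε) ^ k = ∏ _a ∈ Finset.range k, (1 + ε) := by simp
    rw [e, ← Finset.prod_mul_distrib]
    exact Finset.prod_congr rfl fun a _ => by ring
  have hcont : Filter.Tendsto (fun ε : ℝ => (1 + ε) ^ k * ∏ a ∈ Finset.range k, (A a + B a))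
      (nhdsWithin 0 (Set.Ioi 0)) (nhds ((1 + 0) ^ k * ∏ a ∈ Finset.range k, (A a + B a))) := by
    refine Filter.Tendsto.mono_left ?_ nhdsWithin_le_nhds
    exact Continuous.tendsto (by fun_prop) 0
  have := ge_of_tendsto hcont (by
    filter_upwards [Ioo_mem_nhdsGT (zero_lt_one : (0:ℝ) < 1)] with ε hε
    exact key ε hε.1 hε.2)
  simpa using this

/-- log-supermodularity -/
def LSM {L : Type*} [Lattice L] (f : L → ℝ≥0) : Prop :=
  ∀ u v, f u * f v ≤ f (u ⊓ v) * f (u ⊔ v)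

lemma LSM.mul {L : Type*} [Lattice L] {f g : L → ℝ≥0} (hf : LSM f) (hg : LSM g) :
    LSM (fun x => f x * g x) := fun u v => by
  have := mul_le_mul' (hf u v) (hg u v)
  calc _ = f u * f v * (g u * g v) := by ring
    _ ≤ _ := this
    _ = _ := by ring

lemma LSM.prod {L ι : Type*} [Lattice L] (s : Finset ι) {f : ι → L → ℝ≥0}
    (hf : ∀ i ∈ s, LSM (f i)) : LSM (fun x => ∏ i ∈ s, f i x) := fun u v => by
  simp only [← Finset.prod_mul_distrib]
  exact Finset.prod_le_prod' fun i hi => hf i hi u v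

lemma LSM_bool (f : Bool → ℝ≥0) : LSM f := fun u v => by
  cases u <;> cases v <;> simp [mul_comm]

lemma LSM.marg {n : ℕ} {L : Type*} [DistribLattice L] [Fintype L] [DecidableEq L]
    {f : (Fin (n+1) → L) → ℝ≥0} (hf : LSM f) :
    LSM (fun x : Fin n → L => ∑ b : L, f (Fin.cons b x)) := fun u v => by
  refine four_functions_theorem_univ (fun b => f (Fin.cons b u)) (fun b => f (Fin.cons b v))
    (fun b => f (Fin.cons b (u ⊓ v))) (fun b => f (Fin.cons b (u ⊔ v)))
    (fun _ => zero_le) (fun _ => zero_le) (fun _ => zero_le) (fun _ => zero_le) ?_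
  intro a b
  have := hf (Fin.cons a u) (Fin.cons b v)
  rwa [cons_inf, cons_sup] at this

/-- sorted vector -/
def zz {ι : Type*} {k : ℕ} (y : ι → Fin k → Bool) (a : ℕ) : ι → Bool :=
  fun i => decide (a < cnt (y i))

lemma zz_cons {n k : ℕ} (s : Fin k → Bool) (y : Fin n → Fin k → Bool) (a : ℕ) :
    zz (Fin.cons s y : Fin (n+1) → Fin k → Bool) a = Fin.cons (decide (a < cnt s)) (zz y a) := by
  funext i
  refine Fin.cases ?_ (fun j => ?_) i <;> simp [zz]

lemma zz_anti {ι : Type*} {k : ℕ} (y : ι → Fin k → Bool) {a b : ℕ} (h : a ≤ b) :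
    zz y b ≤ zz y a := fun i => by
  simp only [zz]
  rw [Bool.le_iff_imp]
  simp only [decide_eq_true_eq]
  omega

lemma main_ind (k : ℕ) (hk : 1 ≤ k) (n : ℕ) : ∀ (g : (Fin n → Fin k → Bool) → ℝ≥0)
    (f : (Fin n → Bool) → ℝ≥0), LSM g → LSM f →
    (∀ y, g y ≤ ∏ a ∈ Finset.range k, f (zz y a)) → ∑ y, g y ≤ (∑ x, f x) ^ k := by
  induction n with
  | zero =>
    intro g f hg hf hb
    have h := hb default
    have e : ∀ a, zz (default : Fin 0 → Fin k → Bool) a = default := fun a =>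
      Subsingleton.elim _ _
    simp only [e, Finset.prod_const, Finset.card_range] at h
    rw [Fintype.sum_unique, Fintype.sum_unique]
    convert h using 2
    · exact congrArg f (Subsingleton.elim _ _)
  | succ n ih =>
    intro g f hg hf hb
    rw [sum_cons, sum_cons]
    refine ih (fun y => ∑ s, g (Fin.cons s y)) (fun x => ∑ b, f (Fin.cons b x))
      hg.marg hf.marg ?_
    intro y
    have := oneD_nonneg k hk (fun s => (g (Fin.cons s y) : ℝ))
      (fun a => (f (Fin.cons true (zz y a)) : ℝ)) (fun a => (f (Fin.cons false (zz y a)) : ℝ))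
      (fun _ => NNReal.coe_nonneg _) (fun _ => NNReal.coe_nonneg _)
      (fun a b hab => by
        have h := hf (Fin.cons true (zz y b)) (Fin.cons false (zz y a))
        rw [cons_inf, cons_sup, inf_eq_left.2 (zz_anti y hab), sup_eq_right.2 (zz_anti y hab)] at h
        rw [mul_comm (f (Fin.cons true (zz y a)) : ℝ)]
        exact_mod_cast h)
      (fun _ => NNReal.coe_nonneg _)
      (fun s t => by
        have h := hg (Fin.cons s y) (Fin.cons t y)
        rw [cons_inf, cons_sup, inf_idem, sup_idem] at h
        exact_mod_cast h)
      (fun s => by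
        have h := hb (Fin.cons s y)
        simp only [zz_cons] at h
        have h' : (g (Fin.cons s y) : ℝ) ≤
          ((∏ a ∈ Finset.range k, f (Fin.cons (decide (a < cnt s)) (zz y a)) : ℝ≥0) : ℝ) := by
          exact_mod_cast h
        refine h'.trans (le_of_eq ?_)
        rw [NNReal.coe_prod]
        refine Finset.prod_congr rfl fun a _ => ?_
        split_ifs with hc <;> simp [hc])
    simp only [Fintype.sum_bool]
    exact_mod_cast this

lemma sort_ineq {ι : Type*} (ψ : (ι → Bool) → ℝ≥0) (hψ : LSM ψ) (k : ℕ) :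
    ∀ y : ι → Fin k → Bool,
      ∏ a : Fin k, ψ (fun i => y i a) ≤ ∏ a ∈ Finset.range k, ψ (zz y a) := by
  induction k with
  | zero => intro y; simp
  | succ k ih =>
    intro y
    rw [Fin.prod_univ_succ]
    set y' : ι → Fin k → Bool := fun i a => y i a.succ with hy'
    have hc : ∀ i, cnt (y i) = (y i 0).toNat + cnt (y' i) := fun i => by
      rw [← cnt_cons]
      congr 1
      exact (Fin.cons_self_tail (y i)).symm
    set v : ℕ → ι → Bool := fun m i => y i 0 && decide (m ≤ cnt (y' i)) with hv
    have claim : ∀ m, ψ (v 0) * ∏ a ∈ Finset.range m, ψ (zz y' a)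
        ≤ (∏ a ∈ Finset.range m, ψ (zz y a)) * ψ (v m) := by
      intro m
      induction m with
      | zero => simp
      | succ m ihm =>
        rw [Finset.prod_range_succ, Finset.prod_range_succ]
        have h := hψ (v m) (zz y' m)
        have e1 : v m ⊓ zz y' m = v (m+1) := by
          funext i
          simp only [hv, zz, Pi.inf_apply]
          rw [Bool.eq_iff_iff]
          cases y i 0
          · simp
          · simp
            omega
        have e2 : v m ⊔ zz y' m = zz y m := by
          funext i
          simp only [hv, zz, Pi.sup_apply, hc i]
          rw [Bool.eq_iff_iff]
          cases y i 0
          · simp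
          · simp
            omega
        rw [e1, e2] at h
        calc _ = (ψ (v 0) * ∏ a ∈ Finset.range m, ψ (zz y' a)) * ψ (zz y' m) := by ring
          _ ≤ ((∏ a ∈ Finset.range m, ψ (zz y a)) * ψ (v m)) * ψ (zz y' m) :=
            mul_le_mul_left ihm _
          _ = (∏ a ∈ Finset.range m, ψ (zz y a)) * (ψ (v m) * ψ (zz y' m)) := by ring
          _ ≤ (∏ a ∈ Finset.range m, ψ (zz y a)) * (ψ (v (m+1)) * ψ (zz y m)) :=
            mul_le_mul_right h _
          _ = _ := by ring
    have e0 : v 0 = fun i => y i 0 := by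
      funext i
      simp [hv]
    have ek : v k = zz y k := by
      funext i
      have := cnt_le (y' i)
      simp only [hv, zz, hc i]
      rw [Bool.eq_iff_iff]
      cases y i 0
      · simp
        omega
      · simp
        omega
    have := claim k
    rw [e0, ek, ← Finset.prod_range_succ] at this
    exact (mul_le_mul_right (ih y') _).trans this

/-- Theorem 9 of the paper: if `f^G` admits a log-supermodular factorization over
`G = (V, 𝒜)` and `f^H` is the function associated to a permutation-encoded `k`-cover `H`
of `G`, then `Z(H) ≤ Z(G)ᵏ`. -/
theorem cover_partition_le {n k : ℕ} (hk : 1 ≤ k)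
    (𝒜 : Finset (Finset (Fin n)))
    (h𝒜 : ∀ α ∈ 𝒜, α.Nonempty)
    (φ : Fin n → Bool → ℝ≥0)
    (ψ : (α : Finset (Fin n)) → ({ i // i ∈ α } → Bool) → ℝ≥0)
    (hψ : ∀ α ∈ 𝒜, ∀ u v : { i // i ∈ α } → Bool,
      ψ α u * ψ α v ≤ ψ α (u ⊓ v) * ψ α (u ⊔ v))
    (fG : (Fin n → Bool) → ℝ≥0)
    (hfG : ∀ x : Fin n → Bool,
      fG x = (∏ i : Fin n, φ i (x i)) * ∏ α ∈ 𝒜, ψ α (fun i => x i.val))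
    -- the `k`-cover is encoded by a permutation `σ α i` of `{1,…,k}` for each `α ∈ 𝒜`, `i ∈ α`
    (σ : (α : Finset (Fin n)) → { i // i ∈ α } → Equiv.Perm (Fin k))
    (fH : (Fin k → Fin n → Bool) → ℝ≥0)
    (hfH : ∀ x : Fin k → Fin n → Bool,
      fH x = (∏ i : Fin n, ∏ a : Fin k, φ i (x a i)) *
        ∏ α ∈ 𝒜, ∏ a : Fin k, ψ α (fun i => x (σ α i a) i.val)) :
    ∑ x : Fin k → Fin n → Bool, fH x ≤ (∑ x : Fin n → Bool, fG x) ^ k := by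
  have hGl : LSM fG := by
    have : fG = fun x => (∏ i : Fin n, φ i (x i)) * ∏ α ∈ 𝒜, ψ α (fun i => x i.val) := funext hfG
    rw [this]
    refine LSM.mul (LSM.prod _ fun i _ u v => LSM_bool (φ i) (u i) (v i))
      (LSM.prod _ fun α hα u v => hψ α hα _ _)
  set g : (Fin n → Fin k → Bool) → ℝ≥0 := fun y => fH (fun a i => y i a) with hg
  have hgl : LSM g := by
    have : g = fun y => (∏ i : Fin n, ∏ a : Fin k, φ i (y i a)) *
        ∏ α ∈ 𝒜, ∏ a : Fin k, ψ α (fun i => y i.val (σ α i a)) := funext fun y => hfH _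
    rw [this]
    refine LSM.mul (LSM.prod _ fun i _ => LSM.prod _ fun a _ u v =>
        LSM_bool (φ i) (u i a) (v i a))
      (LSM.prod _ fun α hα => LSM.prod _ fun a _ u v => hψ α hα _ _)
  have hb : ∀ y, g y ≤ ∏ a ∈ Finset.range k, fG (zz y a) := by
    intro y
    simp only [hg, hfH, hfG, Finset.prod_mul_distrib]
    refine mul_le_mul' ?_ ?_
    · rw [Finset.prod_comm (s := Finset.range k)]
      refine Finset.prod_le_prod' fun i _ => ?_
      exact sort_ineq (fun x : Fin n → Bool => φ i (x i))
        (fun u v => LSM_bool (φ i) (u i) (v i)) k y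
    · rw [Finset.prod_comm (s := Finset.range k)]
      refine Finset.prod_le_prod' fun α hα => ?_
      refine (sort_ineq (ψ α) (hψ α hα) k (fun i a => y i.val (σ α i a))).trans (le_of_eq ?_)
      refine Finset.prod_congr rfl fun a _ => ?_
      congr 1
      funext i
      simp only [zz]
      rw [cnt_perm (y i.val) (σ α i)]
  have hsum : ∑ x, fH x = ∑ y, g y :=
    (Equiv.sum_comp (Equiv.piComm (fun (_ : Fin n) (_ : Fin k) => Bool)) fH).symm
  rw [hsum]
  exact main_ind k hk n g fG hgl hGl hb
end

section
/- Let G be a finite bipartite graph with parts A, B and edge set E ⊆ A × B, let k ≥ 1, and for each edge e = (a,b) ∈ E let σ_e be a permutation of {1,…,k}. Let H be the graph with vertex set (A ∪ B) × {1,…,k} whose edges are {(a,s), (b,σ_{(a,b)}(s))} for each (a,b) ∈ E and s ∈ {1,…,k} (so H is a k-cover of G). Then the number of independent sets of H is at most the k-th power of the number of independent sets of G. -/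
theorem abel_aux : ∀ (k : ℕ) (D : Fin k → ℝ) (Z : ℝ) (G : ℕ → ℝ), Antitone D → (∀ i, 0 ≤ D i) →
    (∀ i, D i ≤ Z) → 0 ≤ Z → (∀ j, 0 ≤ G j) →
    0 ≤ Z * G 0 + ∑ i : Fin k, D i * (G (i + 1) - G i) := by
  intro k
  induction k with
  | zero => intro D Z G _ _ _ hZ hG; simpa using mul_nonneg hZ (hG 0)
  | succ k ih =>
    intro D Z G hD h0 hDZ hZ hG
    rw [Fin.sum_univ_succ]
    have := ih (fun i => D i.succ) (D 0) (fun j => G (j + 1))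
      (fun i j hij => hD (Fin.succ_le_succ_iff.mpr hij)) (fun i => h0 _)
      (fun i => hD (Fin.zero_le _)) (h0 0) (fun j => hG _)
    have h2 := mul_le_mul_of_nonneg_right (hDZ 0) (hG 0)
    simp only [Fin.val_succ, Fin.val_zero, zero_add] at this ⊢
    linarith

/-- the initial segment of length `j` -/
def initSeg (k j : ℕ) : Finset (Fin k) := Finset.univ.filter (fun i => (i : ℕ) < j)

theorem initSeg_card (k j : ℕ) (h : j ≤ k) : (initSeg k j).card = j := by
  unfold initSeg
  rw [Fin.card_filter_val_lt]; omega

theorem chain_bound (k : ℕ) (F : Finset (Fin k) → ℝ)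
    (hF : ∀ S T, F S + F T ≤ F (S ∩ T) + F (S ∪ T)) (S : Finset (Fin k)) :
    F S ≤ F ∅ + ∑ i ∈ S, (F (initSeg k (i + 1)) - F (initSeg k i)) := by
  have key : ∀ j, F (S ∩ initSeg k j) ≤ F ∅ +
      ∑ i ∈ S ∩ initSeg k j, (F (initSeg k (i + 1)) - F (initSeg k i)) := by
    intro j
    induction j with
    | zero => simp [initSeg]
    | succ j ih =>
      by_cases h : ∃ i : Fin k, i ∈ S ∧ (i : ℕ) = j
      · obtain ⟨i, hi, rfl⟩ := h
        have e1 : S ∩ initSeg k (i + 1) = insert i (S ∩ initSeg k i) := by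
          ext x; simp only [initSeg, Finset.mem_inter, Finset.mem_filter, Finset.mem_univ,
            true_and, Finset.mem_insert]; grind
        have e2 : i ∉ S ∩ initSeg k i := by simp [initSeg]
        have := hF (S ∩ initSeg k (i + 1)) (initSeg k i)
        have e3 : S ∩ initSeg k (i + 1) ∩ initSeg k i = S ∩ initSeg k i := by
          ext x; simp only [initSeg, Finset.mem_inter, Finset.mem_filter, Finset.mem_univ,
            true_and]; grind
        have e4 : S ∩ initSeg k (i + 1) ∪ initSeg k i = initSeg k (i + 1) := by
          ext x; simp only [initSeg, Finset.mem_inter, Finset.mem_filter, Finset.mem_univ,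
            true_and, Finset.mem_union]; grind
        rw [e3, e4] at this
        rw [e1, Finset.sum_insert e2, ← e1]
        linarith
      · have e1 : S ∩ initSeg k (j + 1) = S ∩ initSeg k j := by
          ext x; simp only [initSeg, Finset.mem_inter, Finset.mem_filter, Finset.mem_univ,
            true_and]; grind
        rw [e1]; exact ih
  have := key k
  have e : S ∩ initSeg k k = S := by ext x; simp [initSeg]
  rwa [e] at this

theorem oneDim_sorted (k : ℕ) (f : Finset (Fin k) → ℝ) (a b : Fin k → ℝ)
    (hf : ∀ S, 0 < f S) (ha : ∀ i, 0 < a i) (hb : ∀ i, 0 < b i)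
    (hsm : ∀ S T, f S * f T ≤ f (S ∩ T) * f (S ∪ T))
    (hle : ∀ S, f S ≤ ∏ i : Fin k, if (i : ℕ) < S.card then b i else a i)
    (hD : Antitone (fun i : Fin k => ∑ S, if i ∈ S then f S else 0)) :
    ∑ S, f S ≤ ∏ i, (a i + b i) := by
  set γ : Finset (Fin k) → ℝ := fun S => ∏ i, if i ∈ S then b i else a i with hγ
  have hγpos : ∀ S, 0 < γ S := fun S => Finset.prod_pos (fun i _ => by split_ifs; exacts [hb i, ha i])
  have hprod : ∏ i, (a i + b i) = ∑ S, γ S := by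
    simp_rw [add_comm (a _)]
    rw [Finset.prod_add]
    simp only [Finset.powerset_univ, hγ]
    refine Finset.sum_congr rfl fun S _ => ?_
    rw [Finset.prod_ite]
    congr 2
    · ext; simp
    · ext; simp
  rw [hprod]
  set L : ℕ → ℝ := fun j => ∑ i : Fin k, if (i : ℕ) < j then Real.log (b i) else Real.log (a i) with hL
  set F : Finset (Fin k) → ℝ := fun S => Real.log (f S) with hFdef
  have hF : ∀ S T, F S + F T ≤ F (S ∩ T) + F (S ∪ T) := by
    intro S T
    simp only [hFdef]
    rw [← Real.log_mul (hf _).ne' (hf _).ne', ← Real.log_mul (hf _).ne' (hf _).ne']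
    exact Real.log_le_log (mul_pos (hf _) (hf _)) (hsm S T)
  have hcb := chain_bound k F hF
  have hLs : ∀ i : Fin k, L (i + 1) - L i = Real.log (b i) - Real.log (a i) := by
    intro i
    simp only [hL]
    rw [← Finset.sum_sub_distrib, Finset.sum_eq_single i]
    · simp
    · intro j _ hj
      have : (j : ℕ) ≠ i := fun h => hj (Fin.ext h)
      by_cases h : (j : ℕ) < i
      · simp [h, Nat.lt_succ_of_lt h]
      · have : ¬ (j : ℕ) < i + 1 := by omega
        simp [h, this]
    · simp
  have hlogγ : ∀ S, Real.log (γ S) = L 0 + ∑ i ∈ S, (L (i + 1) - L i) := by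
    intro S
    simp only [hγ]
    rw [Real.log_prod (fun i _ => by split_ifs; exacts [(hb i).ne', (ha i).ne'])]
    simp only [apply_ite Real.log]
    simp_rw [hLs]
    simp only [hL, Nat.not_lt_zero, if_false]
    rw [← Finset.sum_filter_add_sum_filter_not Finset.univ (· ∈ S), ← Finset.sum_filter_add_sum_filter_not Finset.univ (· ∈ S) (fun i => Real.log (a i))]
    rw [Finset.filter_mem_eq_inter, Finset.univ_inter, Finset.sum_sub_distrib]
    have t1 : ∑ i ∈ S, (if i ∈ S then Real.log (b i) else Real.log (a i)) = ∑ i ∈ S, Real.log (b i) :=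
      Finset.sum_congr rfl (fun i hi => if_pos hi)
    have t2 : ∑ i with i ∉ S, (if i ∈ S then Real.log (b i) else Real.log (a i)) =
        ∑ i with i ∉ S, Real.log (a i) :=
      Finset.sum_congr rfl (fun i hi => if_neg (Finset.mem_filter.mp hi).2)
    rw [t1, t2]
    ring
  set G : ℕ → ℝ := fun j => if j ≤ k then L j - F (initSeg k j) else 0 with hG
  have hGnn : ∀ j, 0 ≤ G j := by
    intro j
    simp only [hG]
    split_ifs with h
    · have := Real.log_le_log (hf _) (hle (initSeg k j))
      rw [initSeg_card k j h, Real.log_prod (fun i _ => by split_ifs; exacts [(hb i).ne', (ha i).ne'])] at this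
      simp only [apply_ite Real.log] at this
      simp only [hL, hFdef]; linarith
    · exact le_rfl
  have hab := abel_aux k _ (∑ S, f S) G hD
    (fun i => Finset.sum_nonneg fun S _ => by split_ifs; exacts [(hf S).le, le_rfl])
    (fun i => Finset.sum_le_sum fun S _ => by split_ifs; exacts [le_rfl, (hf S).le])
    (Finset.sum_nonneg fun S _ => (hf S).le) hGnn
  have hswap : (∑ S, f S) * G 0 + ∑ i : Fin k, (∑ S, if i ∈ S then f S else 0) * (G (i + 1) - G i)
      = ∑ S, f S * (G 0 + ∑ i ∈ S, (G (i + 1) - G i)) := by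
    simp_rw [mul_add, Finset.sum_add_distrib, Finset.sum_mul]
    rw [Finset.sum_comm]
    congr 1
    refine Finset.sum_congr rfl fun S _ => ?_
    simp only [ite_mul, zero_mul]
    rw [← Finset.sum_filter, Finset.filter_mem_eq_inter, Finset.univ_inter, Finset.mul_sum]
  rw [hswap] at hab
  have hpt : ∀ S, f S + f S * (G 0 + ∑ i ∈ S, (G (i + 1) - G i)) ≤ γ S := by
    intro S
    have h1 : G 0 + ∑ i ∈ S, (G (i + 1) - G i) ≤ Real.log (γ S / f S) := by
      rw [Real.log_div (hγpos S).ne' (hf S).ne', hlogγ]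
      have h2 := hcb S
      have h3 : ∑ i ∈ S, (G (i + 1) - G i) = ∑ i ∈ S, (L (i + 1) - L i) -
          ∑ i ∈ S, (F (initSeg k (i + 1)) - F (initSeg k i)) := by
        rw [← Finset.sum_sub_distrib]
        refine Finset.sum_congr rfl fun i _ => ?_
        have e1 : (i : ℕ) + 1 ≤ k := i.2
        have e2 : (i : ℕ) ≤ k := i.2.le
        simp only [hG, e1, e2, if_true]; ring
      have h4 : G 0 = L 0 - F ∅ := by simp [hG, initSeg]
      rw [h3, h4]
      simp only [hFdef] at h2 ⊢
      linarith
    have h5 := Real.log_le_sub_one_of_pos (div_pos (hγpos S) (hf S))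
    have h6 := mul_le_mul_of_nonneg_left (h1.trans h5) (hf S).le
    have h7 : f S * (γ S / f S - 1) = γ S - f S := by
      field_simp [(hf S).ne']
    linarith
  have := Finset.sum_le_sum (fun S (_ : S ∈ (Finset.univ : Finset (Finset (Fin k)))) => hpt S)
  rw [Finset.sum_add_distrib] at this
  linarith

theorem oneDim (k : ℕ) (f : Finset (Fin k) → ℝ) (a b : Fin k → ℝ)
    (hf : ∀ S, 0 < f S) (ha : ∀ i, 0 < a i) (hb : ∀ i, 0 < b i)
    (hsm : ∀ S T, f S * f T ≤ f (S ∩ T) * f (S ∪ T))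
    (hle : ∀ S, f S ≤ ∏ i : Fin k, if (i : ℕ) < S.card then b i else a i) :
    ∑ S, f S ≤ ∏ i, (a i + b i) := by
  set d : Fin k → ℝ := fun i => ∑ S, if i ∈ S then f S else 0 with hd
  set π : Equiv.Perm (Fin k) := Tuple.sort (fun i => - d i) with hπ
  have hmono : Monotone ((fun i => - d i) ∘ π) := Tuple.monotone_sort _
  have hsum : ∀ h : Finset (Fin k) → ℝ, ∑ S : Finset (Fin k), h (S.map π.toEmbedding) = ∑ S, h S :=
    fun h => Equiv.sum_comp (Equiv.finsetCongr π) h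
  rw [← hsum]
  refine oneDim_sorted k (fun S => f (S.map π.toEmbedding)) a b (fun S => hf _) ha hb ?_ ?_ ?_
  · intro S T
    simp only [Finset.map_inter, Finset.map_union]
    exact hsm _ _
  · intro S
    simpa using hle (S.map π.toEmbedding)
  · intro i j hij
    have := hmono hij
    simp only [Function.comp, neg_le_neg_iff, hd] at this
    rw [← hsum, ← hsum (fun S => if π i ∈ S then f S else 0)] at this
    simpa using this

theorem multiDim (k : ℕ) : ∀ (n : ℕ) (f : (Fin n → Finset (Fin k)) → ℝ) (g : (Fin n → Bool) → ℝ),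
    (∀ x, 0 < f x) → (∀ w, 0 < g w) →
    (∀ x y, f x * f y ≤ f (x ⊓ y) * f (x ⊔ y)) →
    (∀ x, f x ≤ ∏ i : Fin k, g (fun v => decide ((i : ℕ) < (x v).card))) →
    ∑ x, f x ≤ (∑ w, g w) ^ k := by
  intro n
  induction n with
  | zero =>
    intro f g _ _ _ hle
    simp only [Finset.univ_unique, Finset.sum_singleton]
    refine (hle _).trans (le_of_eq ?_)
    rw [Finset.prod_congr rfl (fun i _ => congrArg g (Subsingleton.elim _ default))]
    rw [Finset.prod_const, Finset.card_univ, Fintype.card_fin]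
    exact congrArg (fun w => g w ^ k) (Subsingleton.elim _ _)
  | succ n ih =>
    intro f g hf hg hsm hle
    have hs1 : ∑ x, f x = ∑ y : Fin n → Finset (Fin k), ∑ S, f (Fin.cons S y) := by
      rw [← Equiv.sum_comp (Fin.consEquiv (fun _ => Finset (Fin k))), Fintype.sum_prod_type,
        Finset.sum_comm]
      rfl
    have hs2 : ∑ w, g w = ∑ y : Fin n → Bool, ∑ S, g (Fin.cons S y) := by
      rw [← Equiv.sum_comp (Fin.consEquiv (fun _ => Bool)), Fintype.sum_prod_type,
        Finset.sum_comm]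
      rfl
    have hinf : ∀ (S T : Finset (Fin k)) (x y : Fin n → Finset (Fin k)),
        (Fin.cons S x ⊓ Fin.cons T y : Fin (n+1) → Finset (Fin k)) = Fin.cons (S ⊓ T) (x ⊓ y) := by
      intro S T x y; funext i; refine Fin.cases ?_ (fun i => ?_) i <;> simp
    have hsup : ∀ (S T : Finset (Fin k)) (x y : Fin n → Finset (Fin k)),
        (Fin.cons S x ⊔ Fin.cons T y : Fin (n+1) → Finset (Fin k)) = Fin.cons (S ⊔ T) (x ⊔ y) := by
      intro S T x y; funext i; refine Fin.cases ?_ (fun i => ?_) i <;> simp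
    rw [hs1, hs2]
    refine ih _ _ (fun y => Finset.sum_pos (fun _ _ => hf _) Finset.univ_nonempty)
      (fun y => Finset.sum_pos (fun _ _ => hg _) Finset.univ_nonempty) ?_ ?_
    · intro x y
      refine four_functions_theorem_univ (fun S => f (Fin.cons S x)) (fun S => f (Fin.cons S y))
        (fun S => f (Fin.cons S (x ⊓ y))) (fun S => f (Fin.cons S (x ⊔ y)))
        (fun S => (hf _).le) (fun S => (hf _).le) (fun S => (hf _).le) (fun S => (hf _).le) ?_
      intro S T
      have := hsm (Fin.cons S x) (Fin.cons T y)
      rwa [hinf, hsup] at this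
    · intro y
      have := oneDim k (fun S => f (Fin.cons S y))
        (fun i => g (Fin.cons false (fun v => decide ((i : ℕ) < (y v).card))))
        (fun i => g (Fin.cons true (fun v => decide ((i : ℕ) < (y v).card))))
        (fun _ => hf _) (fun _ => hg _) (fun _ => hg _) ?_ ?_
      · refine this.trans (le_of_eq (Finset.prod_congr rfl fun i _ => ?_))
        rw [Fintype.sum_bool, add_comm]
      · intro S T
        have := hsm (Fin.cons S y) (Fin.cons T y)
        rw [hinf, hsup] at this
        simpa using this
      · intro S
        refine (hle _).trans (le_of_eq (Finset.prod_congr rfl fun i _ => ?_))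
        have : (fun v => decide ((i : ℕ) < ((Fin.cons S y : Fin (n+1) → Finset (Fin k)) v).card))
          = (Fin.cons (decide ((i : ℕ) < S.card)) (fun v => decide ((i : ℕ) < (y v).card)) : Fin (n+1) → Bool) := by
          funext v; refine Fin.cases ?_ (fun v => ?_) v <;> simp
        rw [this]
        by_cases h : (i : ℕ) < S.card <;> simp [h]

theorem multiDim' {V : Type*} [Fintype V] [DecidableEq V] (k : ℕ)
    (f : (V → Finset (Fin k)) → ℝ) (g : (V → Bool) → ℝ)
    (hf : ∀ x, 0 < f x) (hg : ∀ w, 0 < g w)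
    (hsm : ∀ x y, f x * f y ≤ f (x ⊓ y) * f (x ⊔ y))
    (hle : ∀ x, f x ≤ ∏ i : Fin k, g (fun v => decide ((i : ℕ) < (x v).card))) :
    ∑ x, f x ≤ (∑ w, g w) ^ k := by
  let e := Fintype.equivFin V
  have := multiDim k (Fintype.card V) (fun x => f (x ∘ e)) (fun w => g (w ∘ e))
    (fun _ => hf _) (fun _ => hg _) (fun x y => hsm (x ∘ e) (y ∘ e)) (fun x => hle (x ∘ e))
  have h1 : ∑ x : Fin (Fintype.card V) → Finset (Fin k), f (x ∘ e) = ∑ x, f x :=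
    Equiv.sum_comp (Equiv.arrowCongr e.symm (Equiv.refl _)) f
  have h2 : ∑ x : Fin (Fintype.card V) → Bool, g (x ∘ e) = ∑ x, g x :=
    Equiv.sum_comp (Equiv.arrowCongr e.symm (Equiv.refl _)) g
  rwa [h1, h2] at this

/-- number of violated constraints in the cover -/
def violH {A B : Type*} (E : Finset (A × B)) (k : ℕ)
    (σ : A × B → Equiv.Perm (Fin k)) (x : A ⊕ B → Finset (Fin k)) : ℕ :=
  ∑ e ∈ E, ∑ s : Fin k, if s ∈ x (Sum.inl e.1) ∧ σ e s ∉ x (Sum.inr e.2) then 1 else 0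

/-- number of violated constraints in the base -/
def violG {A B : Type*} (E : Finset (A × B)) (w : A ⊕ B → Bool) : ℕ :=
  ∑ e ∈ E, if w (Sum.inl e.1) = true ∧ w (Sum.inr e.2) = false then 1 else 0

theorem violH_sm {A B : Type*} (E : Finset (A × B)) (k : ℕ)
    (σ : A × B → Equiv.Perm (Fin k)) (x y : A ⊕ B → Finset (Fin k)) :
    violH E k σ (x ⊓ y) + violH E k σ (x ⊔ y) ≤ violH E k σ x + violH E k σ y := by
  unfold violH
  simp only [← Finset.sum_add_distrib]
  refine Finset.sum_le_sum fun e _ => Finset.sum_le_sum fun s _ => ?_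
  simp only [Pi.inf_apply, Pi.sup_apply, Finset.inf_eq_inter, Finset.sup_eq_union,
    Finset.mem_inter, Finset.mem_union]
  by_cases h1 : s ∈ x (Sum.inl e.1) <;> by_cases h2 : s ∈ y (Sum.inl e.1) <;>
  by_cases h3 : σ e s ∈ x (Sum.inr e.2) <;> by_cases h4 : σ e s ∈ y (Sum.inr e.2) <;>
  simp [h1, h2, h3, h4]

theorem viol_le {A B : Type*} (E : Finset (A × B)) (k : ℕ)
    (σ : A × B → Equiv.Perm (Fin k)) (x : A ⊕ B → Finset (Fin k)) :
    ∑ i : Fin k, violG E (fun v => decide ((i : ℕ) < (x v).card)) ≤ violH E k σ x := by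
  unfold violH violG
  rw [Finset.sum_comm]
  refine Finset.sum_le_sum fun e _ => ?_
  rw [← Finset.card_filter, ← Finset.card_filter]
  set X := x (Sum.inl e.1)
  set Y := x (Sum.inr e.2)
  have hX : X.card ≤ k := by simpa using Finset.card_le_univ X
  have e1 : (Finset.univ.filter fun s => s ∈ X ∧ σ e s ∉ Y) = X \ Y.map (σ e).symm.toEmbedding := by
    ext s; simp [Finset.mem_map_equiv]
  rw [e1]
  have h1 := Finset.le_card_sdiff (Y.map (σ e).symm.toEmbedding) X
  rw [Finset.card_map] at h1
  refine le_trans ?_ h1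
  have e2 : (Finset.univ.filter fun i : Fin k => decide ((i : ℕ) < X.card) = true ∧ decide ((i : ℕ) < Y.card) = false) = initSeg k X.card \ initSeg k Y.card := by
    ext s; simp [initSeg]
  rw [e2]
  by_cases h : Y.card ≤ X.card
  · rw [Finset.card_sdiff_of_subset, initSeg_card _ _ hX, initSeg_card _ _ (h.trans hX)]
    intro s; simp only [initSeg, Finset.mem_filter, Finset.mem_univ, true_and]; omega
  · have : initSeg k X.card \ initSeg k Y.card = ∅ := by
      ext s; simp only [initSeg, Finset.mem_sdiff, Finset.mem_filter, Finset.mem_univ, true_and,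
        Finset.notMem_empty, iff_false]; omega
    simp [this]

theorem soft_le {A B : Type*} [Fintype A] [Fintype B] [DecidableEq A] [DecidableEq B]
    (E : Finset (A × B)) (k : ℕ) (σ : A × B → Equiv.Perm (Fin k)) (ε : ℝ) (h0 : 0 < ε)
    (h1 : ε < 1) :
    ∑ x : A ⊕ B → Finset (Fin k), ε ^ violH E k σ x ≤
      (∑ w : A ⊕ B → Bool, ε ^ violG E w) ^ k := by
  refine multiDim' k _ _ (fun _ => pow_pos h0 _) (fun _ => pow_pos h0 _) ?_ ?_
  · intro x y
    rw [← pow_add, ← pow_add]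
    exact pow_le_pow_of_le_one h0.le h1.le (violH_sm E k σ x y)
  · intro x
    rw [Finset.prod_pow_eq_pow_sum]
    exact pow_le_pow_of_le_one h0.le h1.le (viol_le E k σ x)

theorem hard_le {A B : Type*} [Fintype A] [Fintype B] [DecidableEq A] [DecidableEq B]
    (E : Finset (A × B)) (k : ℕ) (σ : A × B → Equiv.Perm (Fin k)) :
    (Finset.univ.filter fun x : A ⊕ B → Finset (Fin k) => violH E k σ x = 0).card ≤
      (Finset.univ.filter fun w : A ⊕ B → Bool => violG E w = 0).card ^ k := by
  have hle : ∑ x : A ⊕ B → Finset (Fin k), (0 : ℝ) ^ violH E k σ x ≤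
      (∑ w : A ⊕ B → Bool, (0 : ℝ) ^ violG E w) ^ k := by
    have c1 : Continuous fun ε : ℝ => ∑ x : A ⊕ B → Finset (Fin k), ε ^ violH E k σ x := by
      fun_prop
    have c2 : Continuous fun ε : ℝ => (∑ w : A ⊕ B → Bool, ε ^ violG E w) ^ k := by
      fun_prop
    refine le_of_tendsto_of_tendsto (b := nhdsWithin (0 : ℝ) (Set.Ioi 0))
      (c1.tendsto 0 |>.mono_left nhdsWithin_le_nhds)
      (c2.tendsto 0 |>.mono_left nhdsWithin_le_nhds) ?_
    filter_upwards [Ioo_mem_nhdsGT (zero_lt_one' ℝ)] with ε hε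
    exact soft_le E k σ ε hε.1 hε.2
  simp only [zero_pow_eq, Finset.sum_boole] at hle
  exact_mod_cast hle

/-- For a finite bipartite graph `G` with parts `A`, `B` and edges `E ⊆ A × B`, and a
`k`-cover `H` of `G` encoded by permutations `σ_e` of `{1,…,k}` (one per edge, so that the
copies `(a,s)` and `(b, σ_{(a,b)}(s))` are adjacent in `H` for each `(a,b) ∈ E`), the
number of independent sets of `H` is at most the `k`-th power of the number of
independent sets of `G`. -/
theorem cover_card_indepSets_le {A B : Type*} [Fintype A] [Fintype B]
    [DecidableEq A] [DecidableEq B]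
    (E : Finset (A × B)) (k : ℕ) (hk : 1 ≤ k)
    (σ : A × B → Equiv.Perm (Fin k)) :
    Nat.card {I : Finset ((A ⊕ B) × Fin k) //
        ∀ e ∈ E, ∀ s : Fin k, ¬((Sum.inl e.1, s) ∈ I ∧ (Sum.inr e.2, σ e s) ∈ I)} ≤
      (Nat.card {I : Finset (A ⊕ B) //
        ∀ e ∈ E, ¬(Sum.inl e.1 ∈ I ∧ Sum.inr e.2 ∈ I)}) ^ k := by
  classical
  refine le_trans ?_ ((hard_le E k σ).trans (Nat.pow_le_pow_left ?_ k))
  · rw [← Fintype.card_subtype, ← Nat.card_eq_fintype_card]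
    refine Nat.card_le_card_of_injective (fun I => ⟨fun v => Sum.elim
      (fun a => Finset.univ.filter fun s => (Sum.inl a, s) ∈ I.1)
      (fun b => Finset.univ.filter fun s => (Sum.inr b, s) ∉ I.1) v, ?_⟩) ?_
    · have h := I.2
      unfold violH
      refine Finset.sum_eq_zero fun e he => Finset.sum_eq_zero fun s _ => ?_
      have := h e he s
      simpa using this
    · intro I J h
      apply Subtype.ext
      have h := congrArg Subtype.val h
      ext ⟨v, s⟩
      have h := Finset.ext_iff.mp (congrFun h v) s
      cases v with
      | inl a => simpa using h
      | inr b => simpa [not_iff_not] using h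
  · rw [← Fintype.card_subtype, ← Nat.card_eq_fintype_card]
    refine Nat.card_le_card_of_injective (fun w => ⟨Finset.univ.filter fun v => Sum.elim
      (fun a => w.1 (Sum.inl a) = true) (fun b => w.1 (Sum.inr b) = false) v, ?_⟩) ?_
    · intro e he
      have h := w.2
      unfold violG at h
      have := (Finset.sum_eq_zero_iff.mp h) e he
      simpa using this
    · intro w w' h
      apply Subtype.ext
      have h := congrArg Subtype.val h
      funext v
      have h := Finset.ext_iff.mp h v
      cases v with
      | inl a =>
        simp only [Finset.mem_filter, Finset.mem_univ, true_and, Sum.elim_inl] at h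
        exact Bool.eq_iff_iff.mpr h
      | inr b =>
        simp only [Finset.mem_filter, Finset.mem_univ, true_and, Sum.elim_inr] at h
        revert h
        cases w.1 (Sum.inr b) <;> cases w'.1 (Sum.inr b) <;> simp
end

section
/- Suppose f : {0,1}^n → ℝ≥0 admits a factorization f(x) = ∏_{i∈V} φ_i(x_i) · ∏_{α∈𝒜} ψ_α(x_α) over G = (V, 𝒜) in which all potentials φ_i and ψ_α are strictly positive and every ψ_α is log-supermodular. Then the Bethe partition function lower-bounds the true partition function: Z_B(G) ≤ Z(G), where Z(G) = ∑_{x∈{0,1}^n} f(x). -/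
namespace BetheAux
open Finset

/-- number of `true` entries -/
def cnt {M : ℕ} (b : Fin M → Bool) : ℕ := (univ.filter (fun m => b m = true)).card

/-- initial segment -/
def seg (M j : ℕ) : Fin M → Bool := fun m => decide (m.val < j)

lemma abel (c T : ℝ) (a δ : ℕ → ℝ) (ha : Antitone a) (ha0 : ∀ m, 0 ≤ a m) (hT : a 0 ≤ T)
    (M : ℕ) (hD : ∀ j ≤ M, 0 ≤ c + ∑ m ∈ range j, δ m) :
    0 ≤ T * c + ∑ m ∈ range M, a m * δ m := by
  have key : ∀ j ≤ M, a j * (c + ∑ m ∈ range j, δ m) ≤ T * c + ∑ m ∈ range j, a m * δ m := by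
    intro j
    induction j with
    | zero =>
      intro _
      have := hD 0 (Nat.zero_le _)
      simp at this ⊢
      exact mul_le_mul_of_nonneg_right hT this
    | succ j ih =>
      intro hj
      have h1 := ih (by omega)
      have h2 := hD (j+1) hj
      have h3 : a (j+1) ≤ a j := ha (Nat.le_succ j)
      rw [sum_range_succ, sum_range_succ]
      rw [sum_range_succ] at h2
      nlinarith [mul_le_mul_of_nonneg_right h3 h2]
  exact le_trans (mul_nonneg (ha0 _) (hD M le_rfl)) (key M le_rfl)

lemma chain_bound {M : ℕ} (a : (Fin M → Bool) → ℝ)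
    (ha : ∀ u v, a u + a v ≤ a (u ⊓ v) + a (u ⊔ v)) (b : Fin M → Bool) :
    a b ≤ a (seg M 0) + ∑ m : Fin M, if b m then (a (seg M (m.val+1)) - a (seg M m.val)) else 0 := by
  have key : ∀ j ≤ M, a (b ⊓ seg M j) ≤ a (seg M 0) + ∑ m ∈ range j,
      if (if h : m < M then b ⟨m, h⟩ else false) then (a (seg M (m+1)) - a (seg M m)) else 0 := by
    intro j
    induction j with
    | zero =>
      intro _
      have : b ⊓ seg M 0 = seg M 0 := by
        funext m; simp [seg]
      simp [this]
    | succ j ih =>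
      intro hj
      have h1 := ih (by omega)
      rw [sum_range_succ]
      have hjM : j < M := hj
      simp only [hjM, dif_pos]
      by_cases hb : b ⟨j, hjM⟩ = true
      · have h2 := ha (b ⊓ seg M (j+1)) (seg M j)
        have e1 : (b ⊓ seg M (j+1)) ⊓ seg M j = b ⊓ seg M j := by
          funext m
          simp only [Pi.inf_apply, seg]
          cases hbm : b m <;> simp
          omega
        have e2 : (b ⊓ seg M (j+1)) ⊔ seg M j = seg M (j+1) := by
          funext m
          simp only [Pi.inf_apply, Pi.sup_apply, seg]
          by_cases hm : m.val = j
          · have : m = ⟨j, hjM⟩ := Fin.ext hm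
            subst this
            simp [hb]
          · cases hbm : b m <;> simp <;> omega
        rw [e1, e2] at h2
        rw [if_pos hb]
        linarith
      · have e1 : b ⊓ seg M (j+1) = b ⊓ seg M j := by
          funext m
          simp only [Pi.inf_apply, seg]
          by_cases hm : m.val = j
          · have : m = ⟨j, hjM⟩ := Fin.ext hm
            subst this
            simp [hb]
          · cases hbm : b m <;> simp <;> omega
        rw [e1, if_neg hb]
        linarith
  have h := key M le_rfl
  have e : b ⊓ seg M M = b := by
    funext m; simp [seg]
  rw [e, Finset.sum_range] at h
  simpa using h

lemma cnt_seg {M j : ℕ} (hj : j ≤ M) : cnt (seg M j) = j := by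
  unfold cnt seg
  simp only [decide_eq_true_eq]
  rw [Fin.card_filter_val_lt]
  omega

/-- One-site inequality, sorted marginals. -/
lemma site_sorted {M : ℕ} (A : (Fin M → Bool) → ℝ) (hA : ∀ b, 0 < A b)
    (hsm : ∀ u v, A u * A v ≤ A (u ⊓ v) * A (u ⊔ v))
    (g : Fin M → Bool → ℝ) (hg : ∀ m c, 0 < g m c)
    (hdom : ∀ b, A b ≤ ∏ m, g m (decide (m.val < cnt b)))
    (hanti : Antitone (fun m : Fin M => ∑ b, if b m then A b else 0)) :
    ∑ b, A b ≤ ∏ m, (g m false + g m true) := by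
  set p : Fin M → ℝ := fun m => ∑ b, if b m then A b else 0 with hp
  have hlog : ∑ b, A b * Real.log (A b) ≤ ∑ b, A b * ∑ m, Real.log (g m (b m)) := by
    set a : (Fin M → Bool) → ℝ := fun b => Real.log (A b) with ha
    have hasm : ∀ u v, a u + a v ≤ a (u ⊓ v) + a (u ⊔ v) := by
      intro u v
      simp only [ha]
      rw [← Real.log_mul (hA _).ne' (hA _).ne', ← Real.log_mul (hA _).ne' (hA _).ne']
      exact Real.log_le_log (mul_pos (hA _) (hA _)) (hsm u v)
    have h1 : ∑ b, A b * a b ≤ ∑ b, A b * (a (seg M 0) + ∑ m : Fin M,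
        if b m then (a (seg M (m.val+1)) - a (seg M m.val)) else 0) :=
      sum_le_sum fun b _ => mul_le_mul_of_nonneg_left (chain_bound a hasm b) (hA b).le
    refine h1.trans ?_
    have swap : ∀ (c : ℝ) (e : Fin M → ℝ), ∑ b, A b * (c + ∑ m : Fin M, if b m then e m else 0)
        = (∑ b, A b) * c + ∑ m, p m * e m := by
      intro c e
      simp only [mul_add, sum_add_distrib, ← sum_mul, hp, mul_sum, sum_mul]
      congr 1
      rw [sum_comm]
      refine sum_congr rfl fun m _ => sum_congr rfl fun b _ => ?_
      split_ifs <;> simp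
    have e2 : ∀ b : Fin M → Bool, ∑ m, Real.log (g m (b m)) = (∑ m, Real.log (g m false)) +
        ∑ m : Fin M, if b m then (Real.log (g m true) - Real.log (g m false)) else 0 := by
      intro b
      rw [← sum_add_distrib]
      refine sum_congr rfl fun m _ => ?_
      cases b m <;> simp
    have e5 : ∑ b, A b * ∑ m, Real.log (g m (b m)) = ∑ b, A b * ((∑ m, Real.log (g m false)) +
        ∑ m : Fin M, if b m then (Real.log (g m true) - Real.log (g m false)) else 0) :=
      sum_congr rfl fun b _ => by rw [e2 b]
    rw [e5, swap, swap]
    -- extend to ℕ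
    let pN : ℕ → ℝ := fun m => if h : m < M then p ⟨m, h⟩ else 0
    let δ : ℕ → ℝ := fun m => if h : m < M then
      (Real.log (g ⟨m, h⟩ true) - Real.log (g ⟨m, h⟩ false)) - (a (seg M (m+1)) - a (seg M m)) else 0
    have hp0 : ∀ m, 0 ≤ p m := fun m => sum_nonneg fun b _ => by
      split_ifs
      · exact (hA b).le
      · exact le_rfl
    have hpT : ∀ m, p m ≤ ∑ b, A b := fun m => sum_le_sum fun b _ => by
      split_ifs
      · exact le_rfl
      · exact (hA b).le
    have hab := abel ((∑ m, Real.log (g m false)) - a (seg M 0)) (∑ b, A b) pN δ ?_ ?_ ?_ M ?_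
    · rw [Finset.sum_range] at hab
      simp only [pN, δ, Fin.is_lt, dif_pos, Fin.eta] at hab
      simp only [mul_sub, sum_sub_distrib] at hab ⊢
      linarith
    · intro i j hij
      simp only [pN]
      by_cases hj : j < M
      · have hi : i < M := by omega
        simp only [hi, hj, dif_pos]
        exact hanti (by simpa using hij)
      · rw [dif_neg hj]
        split_ifs
        · exact hp0 _
        · exact le_rfl
    · intro m
      simp only [pN]
      split_ifs
      · exact hp0 _
      · exact le_rfl
    · simp only [pN]
      split_ifs
      · exact hpT _
      · exact sum_nonneg fun b _ => (hA b).le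
    · intro j hj
      have hd := Real.log_le_log (hA _) (hdom (seg M j))
      rw [cnt_seg hj, Real.log_prod (fun m _ => (hg _ _).ne')] at hd
      have e3 : ∑ m ∈ range j, δ m = ∑ m ∈ range j, (if h : m < M then
          (Real.log (g ⟨m, h⟩ true) - Real.log (g ⟨m, h⟩ false)) else 0)
          - (a (seg M j) - a (seg M 0)) := by
        rw [← sum_range_sub (fun m => a (seg M m)), ← sum_sub_distrib]
        refine sum_congr rfl fun m hm => ?_
        have : m < M := by have := mem_range.1 hm; omega
        simp [δ, this]
      have e4 : ∑ m : Fin M, Real.log (g m (decide (m.val < j))) = (∑ m, Real.log (g m false)) +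
          ∑ m ∈ range j, (if h : m < M then
          (Real.log (g ⟨m, h⟩ true) - Real.log (g ⟨m, h⟩ false)) else 0) := by
        rw [e2 (fun m => decide (m.val < j))]
        congr 1
        have : ∑ m ∈ range j, (if h : m < M then
          (Real.log (g ⟨m, h⟩ true) - Real.log (g ⟨m, h⟩ false)) else 0) = ∑ m ∈ range M, if m < j then (if h : m < M then
          (Real.log (g ⟨m, h⟩ true) - Real.log (g ⟨m, h⟩ false)) else 0) else 0 := by
          rw [← sum_filter]
          refine sum_congr ?_ fun _ _ => rfl
          ext m; simp; omega
        rw [this, Finset.sum_range]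
        simp
      rw [e3]
      rw [e4] at hd
      simp only [ha] at hd ⊢
      linarith
  have hB : ∀ b : Fin M → Bool, 0 < ∏ m, g m (b m) := fun b => prod_pos fun m _ => hg _ _
  have hG : ∏ m, (g m false + g m true) = ∑ b : Fin M → Bool, ∏ m, g m (b m) := by
    have := Finset.prod_univ_sum (fun _ : Fin M => (univ : Finset Bool)) (fun m c => g m c)
    simp only [Fintype.piFinset_univ] at this
    rw [← this]
    refine prod_congr rfl fun m _ => ?_
    simp [add_comm]
  rw [hG]
  have hgibbs : ∀ b, A b - ∏ m, g m (b m) ≤ A b * Real.log (A b) - A b * ∑ m, Real.log (g m (b m)) := by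
    intro b
    rw [← Real.log_prod (fun m _ => (hg _ _).ne')]
    set B := ∏ m, g m (b m)
    have hBb : 0 < B := hB b
    have h := Real.log_le_sub_one_of_pos (div_pos hBb (hA b))
    rw [Real.log_div hBb.ne' (hA b).ne'] at h
    have h2 := mul_le_mul_of_nonneg_left h (hA b).le
    have h3 : A b * (B / A b - 1) = B - A b := by
      have := (hA b).ne'
      field_simp
    rw [h3] at h2
    linarith
  have := sum_le_sum fun b (_ : b ∈ (univ : Finset (Fin M → Bool))) => hgibbs b
  rw [sum_sub_distrib, sum_sub_distrib] at this
  linarith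

lemma cnt_comp {M : ℕ} (b : Fin M → Bool) (s : Equiv.Perm (Fin M)) :
    cnt (fun m => b (s m)) = cnt b := by
  unfold cnt
  refine card_bij (fun m _ => s m) ?_ ?_ ?_
  · intro m hm; simpa using hm
  · intro x _ y _ h; exact s.injective h
  · intro m hm
    exact ⟨s.symm m, by simpa using hm, by simp⟩

lemma site {M : ℕ} (A : (Fin M → Bool) → ℝ) (hA : ∀ b, 0 < A b)
    (hsm : ∀ u v, A u * A v ≤ A (u ⊓ v) * A (u ⊔ v))
    (g : Fin M → Bool → ℝ) (hg : ∀ m c, 0 < g m c)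
    (hdom : ∀ b, A b ≤ ∏ m, g m (decide (m.val < cnt b))) :
    ∑ b, A b ≤ ∏ m, (g m false + g m true) := by
  set p : Fin M → ℝ := fun m => ∑ b, if b m then A b else 0 with hp
  let s : Equiv.Perm (Fin M) := Tuple.sort (fun m => - p m)
  have hs : Monotone ((fun m => - p m) ∘ s) := Tuple.monotone_sort _
  -- A' b = A (b ∘ s⁻¹)
  let E : (Fin M → Bool) ≃ (Fin M → Bool) := Equiv.arrowCongr s (Equiv.refl Bool)
  have hE : ∀ b m, E b m = b (s.symm m) := fun b m => rfl
  have h := site_sorted (fun b => A (E b)) (fun b => hA _) (fun u v => hsm (E u) (E v)) g hg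
    (fun b => by
      have h1 := hdom (E b)
      have : cnt (E b) = cnt b := cnt_comp b s.symm
      rwa [this] at h1) (by
      intro i j hij
      have h1 := hs hij
      simp only [Function.comp, neg_le_neg_iff] at h1
      have h2 : ∀ i, (∑ b : Fin M → Bool, if b i then A (E b) else 0) = p (s i) := by
        intro i
        simp only [hp]
        rw [← Equiv.sum_comp E (fun b => if b (s i) = true then A b else 0)]
        refine sum_congr rfl fun b _ => ?_
        simp [hE]
      simp only [h2]
      exact h1)
  rwa [Equiv.sum_comp E A] at h

/-- The core inequality. -/
lemma core {M : ℕ} : ∀ (n : ℕ) (F : (Fin n → Fin M → Bool) → ℝ) (f : (Fin n → Bool) → ℝ)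
    (_ : ∀ x, 0 < F x) (_ : ∀ x, 0 < f x)
    (_ : ∀ x y, F x * F y ≤ F (x ⊓ y) * F (x ⊔ y))
    (_ : ∀ x, F x ≤ ∏ m : Fin M, f (fun i => decide (m.val < cnt (x i)))),
    ∑ x, F x ≤ (∑ x, f x) ^ M := by
  intro n
  induction n with
  | zero =>
    intro F f hF hf hsm hdom
    rw [Fintype.sum_unique, Fintype.sum_unique]
    have h := hdom (@default _ Unique.instInhabited)
    refine h.trans (le_of_eq ?_)
    rw [prod_congr rfl (g := fun _ => f default) (fun m _ => by congr 1; exact Subsingleton.elim _ _)]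
    rw [prod_const, card_univ, Fintype.card_fin]
    congr 2
    exact Subsingleton.elim _ _
  | succ n ih =>
    intro F f hF hf hsm hdom
    have hcons : ∀ {γ : Type} [Fintype γ] (H : (Fin (n+1) → γ) → ℝ),
        ∑ x, H x = ∑ y : Fin n → γ, ∑ b : γ, H (Fin.cons b y) := by
      intro γ _ H
      rw [sum_comm, ← Fintype.sum_prod_type', ← Equiv.sum_comp (Fin.consEquiv (fun _ => γ))]
      rfl
    rw [hcons F, hcons f]
    refine ih (fun y => ∑ b, F (Fin.cons b y)) (fun z => ∑ c, f (Fin.cons c z)) ?_ ?_ ?_ ?_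
    · intro y; exact sum_pos (fun b _ => hF _) univ_nonempty
    · intro y; exact sum_pos (fun b _ => hf _) univ_nonempty
    · intro y y'
      refine four_functions_theorem_univ (fun b => F (Fin.cons b y)) (fun b => F (Fin.cons b y'))
        (fun b => F (Fin.cons b (y ⊓ y'))) (fun b => F (Fin.cons b (y ⊔ y')))
        (fun b => (hF _).le) (fun b => (hF _).le) (fun b => (hF _).le) (fun b => (hF _).le) ?_
      intro b b'
      have h := hsm (Fin.cons b y) (Fin.cons b' y')
      have e1 : (Fin.cons b y : Fin (n+1) → Fin M → Bool) ⊓ Fin.cons b' y' = Fin.cons (b ⊓ b') (y ⊓ y') := by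
        funext i; refine Fin.cases ?_ (fun i => ?_) i <;> simp
      have e2 : (Fin.cons b y : Fin (n+1) → Fin M → Bool) ⊔ Fin.cons b' y' = Fin.cons (b ⊔ b') (y ⊔ y') := by
        funext i; refine Fin.cases ?_ (fun i => ?_) i <;> simp
      rwa [e1, e2] at h
    · intro y
      have h := site (fun b => F (Fin.cons b y)) (fun b => hF _) ?_
        (fun m c => f (Fin.cons c (fun i => decide (m.val < cnt (y i))))) (fun m c => hf _) ?_
      · refine h.trans (le_of_eq (prod_congr rfl fun m _ => ?_))
        simp [add_comm]
      · intro u v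
        have h := hsm (Fin.cons u y) (Fin.cons v y)
        have e1 : (Fin.cons u y : Fin (n+1) → Fin M → Bool) ⊓ Fin.cons v y = Fin.cons (u ⊓ v) y := by
          funext i; refine Fin.cases ?_ (fun i => ?_) i <;> simp
        have e2 : (Fin.cons u y : Fin (n+1) → Fin M → Bool) ⊔ Fin.cons v y = Fin.cons (u ⊔ v) y := by
          funext i; refine Fin.cases ?_ (fun i => ?_) i <;> simp
        rwa [e1, e2] at h
      · intro b
        refine (hdom _).trans (le_of_eq (prod_congr rfl fun m _ => ?_))
        congr 1
        funext i; refine Fin.cases ?_ (fun i => ?_) i <;> simp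

/-- One bubble pass. -/
lemma bubble {U : Type*} (h : (U → Bool) → ℝ) (hpos : ∀ u, 0 < h u)
    (hsm : ∀ u v, h u * h v ≤ h (u ⊓ v) * h (u ⊔ v)) :
    ∀ (l : List (U → Bool)) (v : U → Bool), ∃ l' : List (U → Bool), l'.length = l.length ∧
      h v * (l.map h).prod ≤ h (fun i => decide (0 < (v :: l).countP (fun u => u i))) * (l'.map h).prod ∧
      ∀ i, l'.countP (fun u => u i) = (v :: l).countP (fun u => u i) - 1 := by
  intro l
  induction l with
  | nil =>
    intro v
    refine ⟨[], rfl, ?_, ?_⟩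
    · have : (fun i => decide (0 < [v].countP (fun u : U → Bool => u i))) = v := by
        funext i
        cases hv : v i <;> simp [hv]
      simp only [this]
      simp
    · intro i
      cases hv : v i <;> simp [hv]
  | cons w l ih =>
    intro v
    obtain ⟨l'', h1, h2, h3⟩ := ih (v ⊔ w)
    refine ⟨(v ⊓ w) :: l'', by simp [h1], ?_, ?_⟩
    · have e : (fun i => decide (0 < (v :: w :: l).countP (fun u : U → Bool => u i)))
          = (fun i => decide (0 < ((v ⊔ w) :: l).countP (fun u : U → Bool => u i))) := by
        funext i
        cases hv : v i <;> cases hw : w i <;> simp [List.countP_cons, hv, hw]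
      rw [e]
      simp only [List.map_cons, List.prod_cons]
      have hl : 0 ≤ (l.map h).prod := List.prod_nonneg (by
        intro x hx
        obtain ⟨u, _, rfl⟩ := List.mem_map.1 hx
        exact (hpos u).le)
      have a1 := mul_le_mul_of_nonneg_right (hsm v w) hl
      have a2 := mul_le_mul_of_nonneg_left h2 (hpos (v ⊓ w)).le
      nlinarith
    · intro i
      have := h3 i
      simp only [List.countP_cons, Pi.sup_apply, Pi.inf_apply] at this ⊢
      rw [this]
      rcases Bool.eq_false_or_eq_true (v i) with hv | hv <;>
        rcases Bool.eq_false_or_eq_true (w i) with hw | hw <;> simp [hv, hw]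

lemma sort_list {U : Type*} (h : (U → Bool) → ℝ) (hpos : ∀ u, 0 < h u)
    (hsm : ∀ u v, h u * h v ≤ h (u ⊓ v) * h (u ⊔ v)) :
    ∀ (M : ℕ) (l : List (U → Bool)), l.length = M →
      (l.map h).prod ≤ ∏ m ∈ range M, h (fun i => decide (m < l.countP (fun u => u i))) := by
  intro M
  induction M with
  | zero =>
    intro l hl
    have : l = [] := List.length_eq_zero_iff.1 hl
    simp [this]
  | succ M ih =>
    intro l hl
    match l, hl with
    | v :: l, hl =>
      obtain ⟨l', h1, h2, h3⟩ := bubble h hpos hsm l v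
      have h4 := ih l' (by simp at hl; omega)
      rw [prod_range_succ']
      simp only [List.map_cons, List.prod_cons]
      refine h2.trans ?_
      rw [mul_comm]
      refine mul_le_mul_of_nonneg_right (h4.trans (le_of_eq ?_)) (hpos _).le
      refine prod_congr rfl fun m _ => ?_
      congr 1
      funext i
      rw [h3]
      congr 1
      apply propext
      omega

lemma sort_fin {U : Type*} (h : (U → Bool) → ℝ) (hpos : ∀ u, 0 < h u)
    (hsm : ∀ u v, h u * h v ≤ h (u ⊓ v) * h (u ⊔ v)) {M : ℕ} (w : Fin M → U → Bool) :
    ∏ m, h (w m) ≤ ∏ m : Fin M, h (fun i => decide (m.val < cnt (fun m => w m i))) := by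
  have h1 := sort_list h hpos hsm M (List.ofFn w) (by simp)
  rw [Finset.prod_range] at h1
  have h2 : ((List.ofFn w).map h).prod = ∏ m, h (w m) := by
    rw [List.map_ofFn, List.prod_ofFn]; rfl
  have h3 : ∀ i, (List.ofFn w).countP (fun u => u i) = cnt (fun m => w m i) := by
    intro i
    unfold cnt
    rw [List.ofFn_eq_map, List.countP_map, List.countP_eq_length_filter]
    simp [Finset.card, Fin.univ_def]
    rfl
  rw [h2] at h1
  simpa only [h3] using h1

/-- number of occurrences of `u` in `w` -/
def typ {U : Type*} [DecidableEq U] {M : ℕ} (w : Fin M → U) (u : U) : ℕ :=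
  (univ.filter (fun m => w m = u)).card

/-- the rearrangements of `w` -/
def orb {U : Type*} [DecidableEq U] {M : ℕ} (w : Fin M → U) : Finset (Fin M → U) :=
  univ.image (fun s : Equiv.Perm (Fin M) => w ∘ s)

lemma mem_orb {U : Type*} [DecidableEq U] {M : ℕ} (w v : Fin M → U) :
    v ∈ orb w ↔ ∃ s : Equiv.Perm (Fin M), w ∘ s = v := by
  simp [orb]

lemma typ_comp {U : Type*} [DecidableEq U] {M : ℕ} (w : Fin M → U) (s : Equiv.Perm (Fin M)) (u : U) :
    typ (w ∘ s) u = typ w u := by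
  unfold typ
  refine card_bij (fun m _ => s m) ?_ ?_ ?_
  · intro m hm; simpa using hm
  · intro x _ y _ h; exact s.injective h
  · intro m hm
    exact ⟨s.symm m, by simpa using hm, by simp⟩

lemma stab_card {U : Type*} [Fintype U] [DecidableEq U] {M : ℕ} (w : Fin M → U) :
    (univ.filter (fun s : Equiv.Perm (Fin M) => w ∘ s = w)).card = ∏ u, (typ w u).factorial := by
  have := DomMulAct.stabilizer_card w
  rw [Fintype.card_subtype] at this
  rw [this]
  refine prod_congr rfl fun u _ => ?_
  rw [Fintype.card_subtype]; rfl

lemma fiber_card {U : Type*} [Fintype U] [DecidableEq U] {M : ℕ} (w v : Fin M → U) (hv : v ∈ orb w) :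
    (univ.filter (fun s : Equiv.Perm (Fin M) => w ∘ s = v)).card = ∏ u, (typ w u).factorial := by
  obtain ⟨t, rfl⟩ := (mem_orb w v).1 hv
  rw [← stab_card]
  refine card_bij (fun s _ => s * t⁻¹) ?_ ?_ ?_
  · intro s hs
    simp only [mem_filter, mem_univ, true_and] at hs ⊢
    funext m
    have := congrFun hs (t⁻¹ m)
    simpa using this
  · intro x _ y _ h; simpa using h
  · intro s hs
    simp only [mem_filter, mem_univ, true_and] at hs
    refine ⟨s * t, ?_, by simp⟩
    simp only [mem_filter, mem_univ, true_and]
    funext m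
    exact congrFun hs (t m)

lemma orb_card {U : Type*} [Fintype U] [DecidableEq U] {M : ℕ} (w : Fin M → U) :
    (orb w).card * ∏ u, (typ w u).factorial = M.factorial := by
  have h := card_eq_sum_card_fiberwise (s := (univ : Finset (Equiv.Perm (Fin M)))) (t := orb w)
    (f := fun s : Equiv.Perm (Fin M) => w ∘ s) (fun s _ => (mem_orb _ _).2 ⟨s, rfl⟩)
  rw [sum_congr rfl (fun v hv => fiber_card w v hv)] at h
  rw [card_univ, Fintype.card_perm, Fintype.card_fin] at h
  rw [h]; simp

lemma mem_orb_of_typ {U : Type*} [DecidableEq U] {M : ℕ} (w v : Fin M → U)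
    (h : ∀ u, typ v u = typ w u) : v ∈ orb w := by
  rw [mem_orb]
  have e : ∀ u, Nonempty ({m // v m = u} ≃ {m // w m = u}) := fun u => by
    rw [← Fintype.card_eq, Fintype.card_subtype, Fintype.card_subtype]
    exact h u
  refine ⟨Equiv.ofFiberEquiv (fun u => (e u).some), ?_⟩
  funext m
  exact Equiv.ofFiberEquiv_map _ m

lemma typ_true {M : ℕ} (b : Fin M → Bool) : typ b true = cnt b := rfl

lemma typ_false {M : ℕ} (b : Fin M → Bool) : typ b false = M - cnt b := by
  have := card_filter_add_card_filter_not (s := (univ : Finset (Fin M))) (fun m => b m = true)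
  simp only [card_univ, Fintype.card_fin, Bool.not_eq_true] at this
  unfold typ cnt
  omega

lemma mem_orb_of_cnt {M : ℕ} (w v : Fin M → Bool) (h : cnt v = cnt w) : v ∈ orb w :=
  mem_orb_of_typ w v (fun u => by cases u <;> simp [typ_true, typ_false, h])

/-- The inequality for a fixed cover. -/
lemma cover_le {n : ℕ} (𝒜 : Finset (Finset (Fin n)))
    (φ : Fin n → Bool → ℝ) (hφ : ∀ i b, 0 < φ i b)
    (ψ : (α : Finset (Fin n)) → ({ i // i ∈ α } → Bool) → ℝ)
    (hψpos : ∀ α ∈ 𝒜, ∀ u : { i // i ∈ α } → Bool, 0 < ψ α u)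
    (hψ : ∀ α ∈ 𝒜, ∀ u v : { i // i ∈ α } → Bool,
      ψ α u * ψ α v ≤ ψ α (u ⊓ v) * ψ α (u ⊔ v))
    {M : ℕ} (σ : (a : 𝒜) → { i // i ∈ a.1 } → Equiv.Perm (Fin M)) :
    ∑ x : Fin n → Fin M → Bool, (∏ i, ∏ m, φ i (x i m)) *
        ∏ a : 𝒜, ∏ m, ψ a.1 (fun i => x i.1 (σ a i m)) ≤
      (∑ x : Fin n → Bool, (∏ i : Fin n, φ i (x i)) * ∏ a : 𝒜, ψ a.1 (fun i => x i.val)) ^ M := by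
  refine core n _ _ ?_ ?_ ?_ ?_
  · intro x
    exact mul_pos (prod_pos fun i _ => prod_pos fun m _ => hφ _ _)
      (prod_pos fun a _ => prod_pos fun m _ => hψpos _ a.2 _)
  · intro x
    exact mul_pos (prod_pos fun i _ => hφ _ _) (prod_pos fun a _ => hψpos _ a.2 _)
  · intro x y
    have e1 : (∏ i, ∏ m, φ i (x i m)) * (∏ i, ∏ m, φ i (y i m)) =
        (∏ i, ∏ m, φ i ((x ⊓ y) i m)) * (∏ i, ∏ m, φ i ((x ⊔ y) i m)) := by
      simp only [← prod_mul_distrib]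
      refine prod_congr rfl fun i _ => prod_congr rfl fun m _ => ?_
      simp only [Pi.inf_apply, Pi.sup_apply]
      cases x i m <;> cases y i m <;> simp [mul_comm]
    have e2 : (∏ a : 𝒜, ∏ m, ψ a.1 (fun i => x i.1 (σ a i m))) *
        (∏ a : 𝒜, ∏ m, ψ a.1 (fun i => y i.1 (σ a i m))) ≤
        (∏ a : 𝒜, ∏ m, ψ a.1 (fun i => (x ⊓ y) i.1 (σ a i m))) *
        (∏ a : 𝒜, ∏ m, ψ a.1 (fun i => (x ⊔ y) i.1 (σ a i m))) := by
      simp only [← prod_mul_distrib]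
      refine prod_le_prod (fun a _ => prod_nonneg fun m _ =>
        (mul_pos (hψpos _ a.2 _) (hψpos _ a.2 _)).le) fun a _ => ?_
      refine prod_le_prod (fun m _ => (mul_pos (hψpos _ a.2 _) (hψpos _ a.2 _)).le) fun m _ => ?_
      exact hψ a.1 a.2 _ _
    have p1 : 0 ≤ (∏ i, ∏ m, φ i (x i m)) * (∏ i, ∏ m, φ i (y i m)) :=
      (mul_pos (prod_pos fun i _ => prod_pos fun m _ => hφ _ _)
        (prod_pos fun i _ => prod_pos fun m _ => hφ _ _)).le
    have := mul_le_mul_of_nonneg_left e2 p1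
    calc _ = _ := mul_mul_mul_comm _ _ _ _
      _ ≤ _ := this
      _ = _ := by rw [e1]; exact mul_mul_mul_comm _ _ _ _
  · intro x
    rw [prod_mul_distrib, prod_comm (s := (univ : Finset (Fin M))),
      prod_comm (s := (univ : Finset (Fin M)))]
    refine mul_le_mul ?_ ?_ (prod_nonneg fun a _ => prod_nonneg fun m _ => (hψpos _ a.2 _).le)
      (prod_nonneg fun i _ => prod_nonneg fun m _ => (hφ _ _).le)
    · refine prod_le_prod (fun i _ => prod_nonneg fun m _ => (hφ _ _).le) fun i _ => ?_
      exact sort_fin (U := Unit) (fun u => φ i (u ())) (fun u => hφ _ _)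
        (fun u v => by
          simp only [Pi.inf_apply, Pi.sup_apply]
          cases u () <;> cases v () <;> simp [mul_comm]) (fun m _ => x i m)
    · refine prod_le_prod (fun a _ => prod_nonneg fun m _ => (hψpos _ a.2 _).le) fun a _ => ?_
      have h := sort_fin (ψ a.1) (hψpos _ a.2) (hψ _ a.2) (fun m i => x i.1 (σ a i m))
      simpa only [cnt_comp] using h

/-- multinomial number of rearrangements -/
noncomputable def mult {U : Type*} [DecidableEq U] {M : ℕ} (w : Fin M → U) : ℝ := ((orb w).card : ℝ)

lemma mult_pos {U : Type*} [DecidableEq U] {M : ℕ} (w : Fin M → U) : 0 < mult w := by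
  unfold mult
  exact_mod_cast card_pos.2 ⟨w, (mem_orb _ _).2 ⟨1, rfl⟩⟩

lemma inner_bound {U : Type*} [Fintype U] [DecidableEq U] {M : ℕ} (h : (U → Bool) → ℝ)
    (hpos : ∀ u, 0 < h u) (w : Fin M → U → Bool) (x0 x : U → Fin M → Bool)
    (hcnt : ∀ i, cnt (fun m => w m i) = cnt (x0 i)) (hx : ∀ i, x i ∈ orb (x0 i)) :
    mult w * (∏ i, ((M.factorial : ℝ) / mult (x0 i))) * ∏ m, h (w m) ≤
      ∑ s : U → Equiv.Perm (Fin M), ∏ m, h (fun i => x i (s i m)) := by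
  have hW : ∀ v ∈ orb w, ∏ m, h (v m) = ∏ m, h (w m) := by
    intro v hv
    obtain ⟨s, rfl⟩ := (mem_orb _ _).1 hv
    exact Equiv.prod_comp s (fun m => h (w m))
  have hD : ∀ i, ((M.factorial : ℝ) / mult (x0 i)) = ((∏ b, (typ (x0 i) b).factorial : ℕ) : ℝ) := by
    intro i
    rw [div_eq_iff (mult_pos _).ne', ← orb_card (x0 i), mult]
    push_cast; ring
  let W : (U → Equiv.Perm (Fin M)) → (Fin M → U → Bool) := fun s m i => x i (s i m)
  have hfib : ∀ v ∈ orb w, ((univ.filter (fun s => W s = v)).card : ℝ)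
      = ∏ i, ((M.factorial : ℝ) / mult (x0 i)) := by
    intro v hv
    simp only [hD]
    rw [← Nat.cast_prod]
    congr 1
    have e : univ.filter (fun s => W s = v) = Fintype.piFinset (fun i =>
        univ.filter (fun s : Equiv.Perm (Fin M) => x i ∘ s = fun m => v m i)) := by
      ext s
      simp only [mem_filter, mem_univ, true_and, Fintype.mem_piFinset, W]
      constructor
      · rintro rfl i; rfl
      · intro h; funext m i; exact congrFun (h i) m
    rw [e, Fintype.card_piFinset]
    refine prod_congr rfl fun i _ => ?_
    obtain ⟨t, ht⟩ := (mem_orb _ _).1 (hx i)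
    rw [fiber_card]
    · refine prod_congr rfl fun b _ => ?_
      rw [← ht, typ_comp]
    · apply mem_orb_of_cnt
      obtain ⟨s, rfl⟩ := (mem_orb _ _).1 hv
      have h1 : cnt (fun m => (w ∘ s) m i) = cnt (fun m => w m i) := cnt_comp (fun m => w m i) s
      have h2 : cnt (x i) = cnt (x0 i) := by rw [← ht]; exact cnt_comp (x0 i) t
      rw [h1, h2, hcnt]
  calc mult w * (∏ i, ((M.factorial : ℝ) / mult (x0 i))) * ∏ m, h (w m)
      = ∑ v ∈ orb w, ∑ s ∈ univ.filter (fun s => W s = v), ∏ m, h (w m) := by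
        simp only [sum_const, nsmul_eq_mul]
        rw [sum_congr rfl (fun v hv => by rw [hfib v hv])]
        simp [mult]; ring
    _ = ∑ v ∈ orb w, ∑ s ∈ univ.filter (fun s => W s = v), ∏ m, h (W s m) := by
        refine sum_congr rfl fun v hv => sum_congr rfl fun s hs => ?_
        rw [(mem_filter.1 hs).2, hW v hv]
    _ ≤ ∑ v, ∑ s ∈ univ.filter (fun s => W s = v), ∏ m, h (W s m) := by
        refine sum_le_sum_of_subset_of_nonneg (subset_univ _) fun v _ _ =>
          sum_nonneg fun s _ => prod_nonneg fun m _ => (hpos _).le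
    _ = _ := sum_fiberwise _ _ _

lemma cover_bound {n : ℕ} (𝒜 : Finset (Finset (Fin n)))
    (φ : Fin n → Bool → ℝ) (hφ : ∀ i b, 0 < φ i b)
    (ψ : (α : Finset (Fin n)) → ({ i // i ∈ α } → Bool) → ℝ)
    (hψpos : ∀ α ∈ 𝒜, ∀ u : { i // i ∈ α } → Bool, 0 < ψ α u)
    (hψ : ∀ α ∈ 𝒜, ∀ u v : { i // i ∈ α } → Bool,
      ψ α u * ψ α v ≤ ψ α (u ⊓ v) * ψ α (u ⊔ v))
    {M : ℕ} (x0 : Fin n → Fin M → Bool) (w : (a : 𝒜) → Fin M → { i // i ∈ a.1 } → Bool)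
    (hcnt : ∀ a i, cnt (fun m => w a m i) = cnt (x0 i.1)) :
    (∏ i, (mult (x0 i) * ∏ m, φ i (x0 i m))) *
      ∏ a : 𝒜, (mult (w a) * (∏ i : { i // i ∈ a.1 }, (mult (x0 i.1))⁻¹) * ∏ m, ψ a.1 (w a m)) ≤
      (∑ x : Fin n → Bool, (∏ i : Fin n, φ i (x i)) * ∏ a : 𝒜, ψ a.1 (fun i => x i.val)) ^ M := by
  set Z := ∑ x : Fin n → Bool, (∏ i : Fin n, φ i (x i)) * ∏ a : 𝒜, ψ a.1 (fun i => x i.val)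
  have hup : ∑ σ : (a : 𝒜) → { i // i ∈ a.1 } → Equiv.Perm (Fin M),
      ∑ x : Fin n → Fin M → Bool, (∏ i, ∏ m, φ i (x i m)) *
        ∏ a : 𝒜, ∏ m, ψ a.1 (fun i => x i.1 (σ a i m)) ≤
      (∏ a : 𝒜, ∏ _i : { i // i ∈ a.1 }, (M.factorial : ℝ)) * Z ^ M := by
    refine (sum_le_sum fun σ _ => cover_le 𝒜 φ hφ ψ hψpos hψ σ).trans (le_of_eq ?_)
    rw [sum_const, nsmul_eq_mul, card_univ, Fintype.card_pi]
    congr 1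
    push_cast
    refine prod_congr rfl fun a _ => ?_
    rw [Fintype.card_pi]
    push_cast
    simp [Fintype.card_perm]
  have hlow : (∏ i, (mult (x0 i) * ∏ m, φ i (x0 i m))) *
      ∏ a : 𝒜, (mult (w a) * (∏ i : { i // i ∈ a.1 }, ((M.factorial : ℝ) / mult (x0 i.1))) *
        ∏ m, ψ a.1 (w a m)) ≤ ∑ σ : (a : 𝒜) → { i // i ∈ a.1 } → Equiv.Perm (Fin M),
      ∑ x : Fin n → Fin M → Bool, (∏ i, ∏ m, φ i (x i m)) *
        ∏ a : 𝒜, ∏ m, ψ a.1 (fun i => x i.1 (σ a i m)) := by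
    rw [sum_comm]
    have e : ∀ x : Fin n → Fin M → Bool, ∑ σ : (a : 𝒜) → { i // i ∈ a.1 } → Equiv.Perm (Fin M),
        (∏ i, ∏ m, φ i (x i m)) * ∏ a : 𝒜, ∏ m, ψ a.1 (fun i => x i.1 (σ a i m)) =
        (∏ i, ∏ m, φ i (x i m)) * ∏ a : 𝒜, ∑ s : { i // i ∈ a.1 } → Equiv.Perm (Fin M),
          ∏ m, ψ a.1 (fun i => x i.1 (s i m)) := by
      intro x
      rw [← mul_sum]
      congr 1
      have := Finset.prod_univ_sum
        (fun a : 𝒜 => (univ : Finset ({ i // i ∈ a.1 } → Equiv.Perm (Fin M))))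
        (fun a s => ∏ m, ψ a.1 (fun i => x i.1 (s i m)))
      rw [Fintype.piFinset_univ] at this
      exact this.symm
    simp only [e]
    have hnn : ∀ x : Fin n → Fin M → Bool, 0 ≤ (∏ i, ∏ m, φ i (x i m)) *
        ∏ a : 𝒜, ∑ s : { i // i ∈ a.1 } → Equiv.Perm (Fin M),
          ∏ m, ψ a.1 (fun i => x i.1 (s i m)) := fun x =>
      mul_nonneg (prod_nonneg fun i _ => prod_nonneg fun m _ => (hφ _ _).le)
        (prod_nonneg fun a _ => sum_nonneg fun s _ => prod_nonneg fun m _ => (hψpos _ a.2 _).le)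
    refine le_trans ?_ (sum_le_sum_of_subset_of_nonneg
      (subset_univ (Fintype.piFinset fun i => orb (x0 i))) fun x _ _ => hnn x)
    have hb : ∀ x ∈ Fintype.piFinset (fun i => orb (x0 i)),
        (∏ i, ∏ m, φ i (x0 i m)) * ∏ a : 𝒜, (mult (w a) *
          (∏ i : { i // i ∈ a.1 }, ((M.factorial : ℝ) / mult (x0 i.1))) * ∏ m, ψ a.1 (w a m)) ≤
        (∏ i, ∏ m, φ i (x i m)) * ∏ a : 𝒜, ∑ s : { i // i ∈ a.1 } → Equiv.Perm (Fin M),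
          ∏ m, ψ a.1 (fun i => x i.1 (s i m)) := by
      intro x hx
      rw [Fintype.mem_piFinset] at hx
      have e1 : (∏ i, ∏ m, φ i (x i m)) = ∏ i, ∏ m, φ i (x0 i m) := by
        refine prod_congr rfl fun i _ => ?_
        obtain ⟨t, ht⟩ := (mem_orb _ _).1 (hx i)
        rw [← ht]
        exact Equiv.prod_comp t (fun m => φ i (x0 i m))
      rw [e1]
      refine mul_le_mul_of_nonneg_left ?_ (prod_nonneg fun i _ => prod_nonneg fun m _ => (hφ _ _).le)
      refine prod_le_prod (fun a _ => ?_) fun a _ => ?_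
      · refine mul_nonneg (mul_nonneg (mult_pos _).le (prod_nonneg fun i _ => ?_))
          (prod_nonneg fun m _ => (hψpos _ a.2 _).le)
        exact div_nonneg (Nat.cast_nonneg _) (mult_pos _).le
      · exact inner_bound (ψ a.1) (hψpos _ a.2) (w a) (fun i => x0 i.1) (fun i => x i.1)
          (hcnt a) (fun i => hx i.1)
    refine le_trans (le_of_eq ?_) (sum_le_sum hb)
    rw [sum_const, nsmul_eq_mul, Fintype.card_piFinset, prod_mul_distrib]
    push_cast
    simp only [mult]
    ring
  have hfin := hlow.trans hup
  have hP : 0 < ∏ a : 𝒜, ∏ _i : { i // i ∈ a.1 }, (M.factorial : ℝ) :=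
    prod_pos fun a _ => prod_pos fun i _ => by exact_mod_cast M.factorial_pos
  refine le_of_mul_le_mul_left ?_ hP
  refine le_trans (le_of_eq ?_) hfin
  rw [mul_left_comm, ← prod_mul_distrib]
  congr 1
  refine prod_congr rfl fun a _ => ?_
  simp only [div_eq_mul_inv, prod_mul_distrib]
  ring

lemma rounding {U : Type*} [Fintype U] [DecidableEq U] (τ : (U → Bool) → ℝ) (hτ0 : ∀ u, 0 ≤ τ u)
    (hτ1 : ∑ u, τ u = 1) (N L : ℕ) (hL : Fintype.card (U → Bool) ≤ L) (K : U → ℕ)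
    (hK : ∀ i, K i = ⌊(N : ℝ) * ∑ u ∈ univ.filter (fun u : U → Bool => u i = true), τ u⌋₊) :
    ∃ w : Fin (N + L) → U → Bool, (∀ i, cnt (fun m => w m i) = K i) ∧
      ∀ u, |(typ w u : ℝ) - N * τ u| ≤ 2 * L := by
  let fl : (U → Bool) → ℕ := fun u => ⌊(N : ℝ) * τ u⌋₊
  have hfl1 : ∀ u, (fl u : ℝ) ≤ N * τ u := fun u =>
    Nat.floor_le (mul_nonneg (Nat.cast_nonneg _) (hτ0 u))
  have hfl2 : ∀ u, (N : ℝ) * τ u ≤ fl u + 1 := fun u => (Nat.lt_floor_add_one _).le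
  have hS : ∑ u, fl u ≤ N := by
    have : ((∑ u, fl u : ℕ) : ℝ) ≤ N := by
      push_cast
      refine (sum_le_sum fun u _ => hfl1 u).trans (le_of_eq ?_)
      rw [← mul_sum, hτ1, mul_one]
    exact_mod_cast this
  have hS2 : N ≤ ∑ u, fl u + L := by
    have : (N : ℝ) ≤ ((∑ u, fl u + L : ℕ) : ℝ) := by
      push_cast
      have h1 : (N : ℝ) = ∑ u, (N : ℝ) * τ u := by rw [← mul_sum, hτ1, mul_one]
      have h2 := sum_le_sum fun u (_ : u ∈ (univ : Finset (U → Bool))) => hfl2 u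
      rw [sum_add_distrib, sum_const, card_univ, nsmul_eq_mul, mul_one] at h2
      have h3 : ((Fintype.card (U → Bool) : ℕ) : ℝ) ≤ L := by exact_mod_cast hL
      linarith
    exact_mod_cast this
  let k : U → ℕ := fun i => ∑ u, if u i = true then fl u else 0
  have hk1 : ∀ i, k i ≤ K i := by
    intro i
    rw [hK]
    apply Nat.le_floor
    simp only [k]
    push_cast
    rw [mul_sum, sum_filter]
    refine sum_le_sum fun u _ => ?_
    split_ifs
    · exact hfl1 u
    · simp
  have hk2 : ∀ i, K i ≤ k i + L := by
    intro i
    have : ((K i : ℕ) : ℝ) ≤ ((k i + L : ℕ) : ℝ) := by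
      rw [hK]
      refine (Nat.floor_le (mul_nonneg (Nat.cast_nonneg _) (sum_nonneg fun u _ => hτ0 u))).trans ?_
      simp only [k]
      push_cast
      have h3 : ((Fintype.card (U → Bool) : ℕ) : ℝ) ≤ L := by exact_mod_cast hL
      rw [mul_sum, sum_filter]
      have h2 : ∑ u : U → Bool, (if u i = true then (N : ℝ) * τ u else 0) ≤
          ∑ u : U → Bool, ((if u i = true then (fl u : ℝ) else 0) + 1) := by
        refine sum_le_sum fun u _ => ?_
        split_ifs
        · exact hfl2 u
        · simp
      rw [sum_add_distrib, sum_const, card_univ, nsmul_eq_mul, mul_one] at h2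
      linarith
    exact_mod_cast this
  let R := N + L - ∑ u, fl u
  let B := (Σ u : U → Bool, Fin (fl u)) ⊕ Fin R
  have hcard : Fintype.card (Fin (N + L)) = Fintype.card B := by
    simp only [B, R, Fintype.card_fin, Fintype.card_sum, Fintype.card_sigma]
    omega
  let e : Fin (N + L) ≃ B := Fintype.equivOfCardEq hcard
  obtain ⟨wB, hinl, hinr⟩ : ∃ wB : B → U → Bool, (∀ p, wB (Sum.inl p) = p.1) ∧
      (∀ s : Fin R, wB (Sum.inr s) = fun i => decide (s.val < K i - k i)) :=
    ⟨Sum.elim (fun p => p.1) (fun s i => decide (s.val < K i - k i)), fun _ => rfl, fun _ => rfl⟩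
  refine ⟨fun m => wB (e m), ?_, ?_⟩
  · intro i
    unfold cnt
    rw [card_filter, Equiv.sum_comp e (fun b => if wB b i = true then 1 else 0)]
    simp only [B, Fintype.sum_sum_type, Fintype.sum_sigma, hinl, hinr]
    have h1 : ∀ u : U → Bool, ∑ _y : Fin (fl u), (if u i = true then 1 else 0) =
        if u i = true then fl u else 0 := by
      intro u; split_ifs <;> simp
    simp only [h1]
    have h2 : ∑ s : Fin R, (if decide (s.val < K i - k i) = true then 1 else 0) = K i - k i := by
      rw [← card_filter]
      have := cnt_seg (M := R) (j := K i - k i) (by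
        have := hk2 i
        simp only [R]; omega)
      exact this
    rw [h2]
    have := hk1 i
    change k i + (K i - k i) = K i
    omega
  · intro u
    have ht : typ (fun m => wB (e m)) u = fl u +
        (univ.filter (fun s : Fin R => (fun i => decide (s.val < K i - k i)) = u)).card := by
      unfold typ
      rw [card_filter, Equiv.sum_comp e (fun b => if wB b = u then 1 else 0)]
      simp only [B, Fintype.sum_sum_type, Fintype.sum_sigma, hinl, hinr]
      rw [card_filter]
      congr 1
      have h1 : ∀ v : U → Bool, ∑ _y : Fin (fl v), (if v = u then 1 else 0) =
          if v = u then fl v else 0 := by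
        intro v; split_ifs <;> simp
      simp only [h1]
      simp
    have hle : (univ.filter (fun s : Fin R => (fun i => decide (s.val < K i - k i)) = u)).card ≤ 2 * L := by
      refine (card_le_univ _).trans ?_
      rw [Fintype.card_fin]
      simp only [R]; omega
    have hle' : (((univ.filter (fun s : Fin R => (fun i => decide (s.val < K i - k i)) = u)).card : ℕ) : ℝ)
        ≤ 2 * L := by exact_mod_cast hle
    have hL1 : (1 : ℝ) ≤ L := by
      have : 1 ≤ L := le_trans (Fintype.card_pos) hL
      exact_mod_cast this
    rw [ht]
    push_cast
    have h0 : (0 : ℝ) ≤ (((univ.filter (fun s : Fin R =>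
      (fun i => decide (s.val < K i - k i)) = u)).card : ℕ) : ℝ) := Nat.cast_nonneg _
    rw [abs_le]
    constructor <;> linarith [hfl1 u, hfl2 u]

/-- error term in the Stirling formula -/
noncomputable def lf (n : ℕ) : ℝ := Real.log (n.factorial) - (n * Real.log n - n)

lemma lf_bounds (n : ℕ) : 0 ≤ lf n ∧ lf n ≤ 1 + Real.log n := by
  rcases Nat.eq_zero_or_pos n with rfl | hn
  · simp [lf]
  · induction n, hn using Nat.le_induction with
    | base => simp [lf]
    | succ n hn ih =>
      have hn' : (0 : ℝ) < n := by exact_mod_cast hn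
      have hd : lf (n+1) = lf n + 1 - n * (Real.log (n+1) - Real.log n) := by
        unfold lf
        rw [Nat.factorial_succ]
        push_cast
        rw [Real.log_mul (by positivity) (by positivity)]
        ring
      have h1 : Real.log (n+1) - Real.log n ≤ 1 / n := by
        rw [← Real.log_div (by positivity) (by positivity)]
        refine (Real.log_le_sub_one_of_pos (by positivity)).trans (le_of_eq ?_)
        field_simp
        ring
      have h2 : 1 / ((n : ℝ) + 1) ≤ Real.log (n+1) - Real.log n := by
        have := Real.log_le_sub_one_of_pos (show (0 : ℝ) < n / (n+1) by positivity)
        rw [Real.log_div (by positivity) (by positivity)] at this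
        have e : (n : ℝ) / (n+1) - 1 = - (1 / (n+1)) := by field_simp; ring
        linarith
      have h3 : n * (Real.log (n+1) - Real.log n) ≤ 1 := by
        have := mul_le_mul_of_nonneg_left h1 hn'.le
        rwa [mul_one_div_cancel hn'.ne'] at this
      have h4 : 1 ≤ (n + 1) * (Real.log (n+1) - Real.log n) := by
        have := mul_le_mul_of_nonneg_left h2 (show (0 : ℝ) ≤ n + 1 by positivity)
        rwa [mul_one_div_cancel (by positivity)] at this
      push_cast
      constructor <;> nlinarith [ih.1, ih.2]

lemma sum_typ {U : Type*} [Fintype U] [DecidableEq U] {M : ℕ} (w : Fin M → U) :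
    ∑ u, typ w u = M := by
  have h := card_eq_sum_card_fiberwise (s := (univ : Finset (Fin M))) (t := (univ : Finset U))
    (f := w) (fun s _ => by simp)
  rw [card_univ, Fintype.card_fin] at h
  exact h.symm

lemma log_mult {U : Type*} [Fintype U] [DecidableEq U] {M : ℕ} (hM : 0 < M) (w : Fin M → U) :
    Real.log (mult w) / M = ∑ u, Real.negMulLog (typ w u / M) + (lf M / M - ∑ u, lf (typ w u) / M) := by
  have hM' : (0 : ℝ) < M := by exact_mod_cast hM
  have h1 : Real.log (mult w) = Real.log M.factorial - ∑ u, Real.log (typ w u).factorial := by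
    have h := congrArg (fun k : ℕ => Real.log (k : ℝ)) (orb_card w)
    simp only [Nat.cast_mul, Nat.cast_prod] at h
    change Real.log (mult w * _) = _ at h
    have hne : ∀ u, ((typ w u).factorial : ℝ) ≠ 0 := fun u => by positivity
    rw [Real.log_mul (mult_pos w).ne' (prod_ne_zero_iff.2 fun u _ => hne u),
      Real.log_prod (fun u _ => hne u)] at h
    linarith
  have h2 : ∀ u, Real.negMulLog (typ w u / M) * M = - (typ w u * Real.log (typ w u)) + typ w u * Real.log M := by
    intro u
    unfold Real.negMulLog
    rcases Nat.eq_zero_or_pos (typ w u) with h0 | h0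
    · simp [h0]
    · have : (0 : ℝ) < typ w u := by exact_mod_cast h0
      rw [Real.log_div this.ne' hM'.ne']
      field_simp
      ring
  have hs : ∑ u, (typ w u : ℝ) = M := by exact_mod_cast sum_typ w
  rw [div_eq_iff hM'.ne', add_mul, sum_mul, sub_mul, sum_mul]
  simp only [h2, div_mul_cancel₀ _ hM'.ne']
  rw [h1]
  simp only [lf, sum_add_distrib, sum_sub_distrib, sum_neg_distrib]
  rw [← sum_mul, hs]
  ring

open Filter Topology in
lemma typ_tendsto {U : Type*} [DecidableEq U] (L C : ℕ) (w : (N : ℕ) → Fin (N + L) → U)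
    (τ : U → ℝ) (h : ∀ N u, |(typ (w N) u : ℝ) - N * τ u| ≤ C) (u : U) :
    Tendsto (fun N : ℕ => (typ (w N) u : ℝ) / ((N + L : ℕ) : ℝ)) atTop (𝓝 (τ u)) := by
  have hM : Tendsto (fun N : ℕ => ((N + L : ℕ) : ℝ)) atTop atTop :=
    tendsto_natCast_atTop_atTop.comp (tendsto_add_atTop_nat L)
  rw [tendsto_iff_dist_tendsto_zero]
  have hlim : Tendsto (fun N : ℕ => (C + L * |τ u|) / ((N + L : ℕ) : ℝ)) atTop (𝓝 0) :=
    hM.const_div_atTop _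
  refine squeeze_zero' (Eventually.of_forall fun N => dist_nonneg) ?_ hlim
  filter_upwards [eventually_gt_atTop 0] with N hN
  have hpos : (0 : ℝ) < ((N + L : ℕ) : ℝ) := by
    have : 0 < N + L := by omega
    exact_mod_cast this
  rw [Real.dist_eq, div_sub' hpos.ne', abs_div, abs_of_pos hpos]
  refine div_le_div_of_nonneg_right ?_ hpos.le
  have e : (typ (w N) u : ℝ) - ((N + L : ℕ) : ℝ) * τ u = ((typ (w N) u : ℝ) - N * τ u) - L * τ u := by
    push_cast; ring
  rw [e]
  refine (abs_sub _ _).trans ?_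
  rw [abs_mul, Nat.abs_cast]
  linarith [h N u]

open Filter Topology in
lemma mult_tendsto {U : Type*} [Fintype U] [DecidableEq U] (L C : ℕ) (w : (N : ℕ) → Fin (N + L) → U)
    (τ : U → ℝ) (h : ∀ N u, |(typ (w N) u : ℝ) - N * τ u| ≤ C) :
    Tendsto (fun N : ℕ => Real.log (mult (w N)) / ((N + L : ℕ) : ℝ)) atTop
      (𝓝 (∑ u, Real.negMulLog (τ u))) := by
  have hM : Tendsto (fun N : ℕ => ((N + L : ℕ) : ℝ)) atTop atTop :=
    tendsto_natCast_atTop_atTop.comp (tendsto_add_atTop_nat L)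
  have hlogM : Tendsto (fun N : ℕ => (1 + Real.log ((N + L : ℕ) : ℝ)) / ((N + L : ℕ) : ℝ)) atTop (𝓝 0) := by
    have h1 : Tendsto (fun x : ℝ => (1 + Real.log x) / x) atTop (𝓝 0) := by
      have a1 : Tendsto (fun x : ℝ => Real.log x / x) atTop (𝓝 0) :=
        Real.isLittleO_log_id_atTop.tendsto_div_nhds_zero
      have a2 : Tendsto (fun x : ℝ => 1 / x) atTop (𝓝 0) := tendsto_id.const_div_atTop 1
      have := a2.add a1
      simp only [add_zero] at this
      refine this.congr fun x => ?_
      rw [add_div]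
    exact h1.comp hM
  have hlf : ∀ c : ℕ → ℕ, (∀ N, c N ≤ N + L) →
      Tendsto (fun N : ℕ => lf (c N) / ((N + L : ℕ) : ℝ)) atTop (𝓝 0) := by
    intro c hc
    refine squeeze_zero' (Eventually.of_forall fun N =>
      div_nonneg (lf_bounds _).1 (Nat.cast_nonneg _)) ?_ hlogM
    filter_upwards [eventually_gt_atTop 0] with N hN
    refine div_le_div_of_nonneg_right ((lf_bounds _).2.trans ?_) (Nat.cast_nonneg _)
    rcases Nat.eq_zero_or_pos (c N) with h0 | h0
    · rw [h0]
      simp only [Nat.cast_zero, Real.log_zero]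
      have : 0 ≤ Real.log ((N + L : ℕ) : ℝ) := Real.log_natCast_nonneg _
      linarith
    · have := Real.log_le_log (show (0 : ℝ) < c N by exact_mod_cast h0)
        (show (c N : ℝ) ≤ ((N + L : ℕ) : ℝ) by exact_mod_cast hc N)
      linarith
  have hmain : Tendsto (fun N : ℕ => ∑ u, Real.negMulLog (typ (w N) u / ((N + L : ℕ) : ℝ)) +
      (lf (N + L) / ((N + L : ℕ) : ℝ) - ∑ u, lf (typ (w N) u) / ((N + L : ℕ) : ℝ))) atTop
      (𝓝 (∑ u, Real.negMulLog (τ u) + (0 - ∑ _u : U, (0 : ℝ)))) := by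
    refine Tendsto.add (tendsto_finsetSum _ fun u _ => ?_) (Tendsto.sub (hlf _ fun N => le_rfl)
      (tendsto_finsetSum _ fun u _ => hlf _ fun N => ?_))
    · exact (Real.continuous_negMulLog.tendsto _).comp (typ_tendsto L C w τ h u)
    · refine (card_le_univ _).trans ?_
      simp
  simp only [sum_const_zero, sub_zero, add_zero] at hmain
  refine hmain.congr' ?_
  filter_upwards [eventually_gt_atTop 0] with N hN
  exact (log_mult (by omega) (w N)).symm

lemma log_prod_typ {U : Type*} [Fintype U] [DecidableEq U] {M : ℕ} (w : Fin M → U) (g : U → ℝ)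
    (hg : ∀ u, 0 < g u) :
    Real.log (∏ m, g (w m)) / M = ∑ u, (typ w u / M : ℝ) * Real.log (g u) := by
  rw [Real.log_prod (fun m _ => (hg _).ne'), ← sum_fiberwise (univ : Finset (Fin M)) w, sum_div]
  refine sum_congr rfl fun u _ => ?_
  rw [sum_congr rfl (g := fun _ => Real.log (g u)) (fun m hm => by rw [(mem_filter.1 hm).2])]
  rw [sum_const, nsmul_eq_mul]
  unfold typ
  ring

lemma bethe_conv {U : Type*} [Fintype U] [DecidableEq U] (τ : (U → Bool) → ℝ) (hτ0 : ∀ u, 0 ≤ τ u)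
    (q : U → Bool → ℝ)
    (hq : ∀ i b, ∑ u ∈ univ.filter (fun u : U → Bool => u i = b), τ u = q i b) :
    ∑ u, τ u * Real.log (τ u / ∏ i, q i (u i)) =
      - ∑ u, Real.negMulLog (τ u) + ∑ i, ∑ b, Real.negMulLog (q i b) := by
  have h1 : ∀ u, τ u * Real.log (τ u / ∏ i, q i (u i)) =
      - Real.negMulLog (τ u) - ∑ i, τ u * Real.log (q i (u i)) := by
    intro u
    rcases (hτ0 u).eq_or_lt with h0 | h0
    · simp [← h0]
    · have hq0 : ∀ i, q i (u i) ≠ 0 := by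
        intro i
        rw [← hq]
        have : τ u ≤ ∑ v ∈ univ.filter (fun v : U → Bool => v i = u i), τ v :=
          single_le_sum (fun v _ => hτ0 v) (by simp)
        linarith
      rw [Real.log_div h0.ne' (prod_ne_zero_iff.2 fun i _ => hq0 i), Real.log_prod (fun i _ => hq0 i),
        Real.negMulLog, ← mul_sum]
      ring
  simp only [h1, sum_sub_distrib, sum_neg_distrib]
  rw [sum_comm]
  have h2 : ∀ i, ∑ u, τ u * Real.log (q i (u i)) = - ∑ b, Real.negMulLog (q i b) := by
    intro i
    rw [← sum_fiberwise (univ : Finset (U → Bool)) (fun u => u i), ← sum_neg_distrib]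
    refine sum_congr rfl fun b _ => ?_
    rw [sum_congr rfl (g := fun u => τ u * Real.log (q i b))
      (fun u hu => by rw [(mem_filter.1 hu).2]), ← sum_mul, hq]
    unfold Real.negMulLog
    ring
  simp only [h2, sum_neg_distrib]
  ring

open Filter Topology in
lemma bethe_log {n : ℕ}
    (𝒜 : Finset (Finset (Fin n)))
    (h𝒜 : ∀ α ∈ 𝒜, α.Nonempty)
    (φ : Fin n → Bool → ℝ) (hφ : ∀ i b, 0 < φ i b)
    (ψ : (α : Finset (Fin n)) → ({ i // i ∈ α } → Bool) → ℝ)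
    (hψpos : ∀ α ∈ 𝒜, ∀ u : { i // i ∈ α } → Bool, 0 < ψ α u)
    (hψ : ∀ α ∈ 𝒜, ∀ u v : { i // i ∈ α } → Bool,
      ψ α u * ψ α v ≤ ψ α (u ⊓ v) * ψ α (u ⊔ v))
    (τv : Fin n → Bool → ℝ)
    (τf : (α : Finset (Fin n)) → ({ i // i ∈ α } → Bool) → ℝ)
    (hτv0 : ∀ i b, 0 ≤ τv i b)
    (hτf0 : ∀ α ∈ 𝒜, ∀ u : { i // i ∈ α } → Bool, 0 ≤ τf α u)
    (hτv1 : ∀ i, ∑ b : Bool, τv i b = 1)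
    (hcons : ∀ α ∈ 𝒜, ∀ i : { i // i ∈ α }, ∀ b : Bool,
      ∑ u ∈ Finset.univ.filter (fun u : { i // i ∈ α } → Bool => u i = b), τf α u
        = τv i.val b) :
    (∑ i, (∑ b, Real.negMulLog (τv i b) + ∑ b, τv i b * Real.log (φ i b))) +
      ∑ a : 𝒜, (∑ u, Real.negMulLog (τf a.1 u)
        - ∑ i : { i // i ∈ a.1 }, ∑ b, Real.negMulLog (τv i.1 b)
        + ∑ u, τf a.1 u * Real.log (ψ a.1 u)) ≤
    Real.log (∑ x : Fin n → Bool, (∏ i : Fin n, φ i (x i)) * ∏ a : 𝒜, ψ a.1 (fun i => x i.val)) := by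
  set Z := ∑ x : Fin n → Bool, (∏ i : Fin n, φ i (x i)) * ∏ a : 𝒜, ψ a.1 (fun i => x i.val) with hZ
  have hZpos : 0 < Z := sum_pos (fun x _ => mul_pos (prod_pos fun i _ => hφ _ _)
    (prod_pos fun a _ => hψpos _ a.2 _)) univ_nonempty
  let L : ℕ := 2 ^ n
  have hL1 : 1 ≤ L := Nat.one_le_two_pow
  have hsum1 : ∀ a : 𝒜, ∑ u, τf a.1 u = 1 := by
    intro a
    obtain ⟨i, hi⟩ := h𝒜 a.1 a.2
    rw [← hτv1 i, ← sum_fiberwise (univ : Finset ({ i // i ∈ a.1 } → Bool)) (fun u => u ⟨i, hi⟩)]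
    exact sum_congr rfl fun b _ => hcons a.1 a.2 ⟨i, hi⟩ b
  let K : ℕ → Fin n → ℕ := fun N i => ⌊(N : ℝ) * τv i true⌋₊
  have hvt : ∀ i, τv i true + τv i false = 1 := fun i => by
    have := hτv1 i
    simpa using this
  have hK1 : ∀ N i, (K N i : ℝ) ≤ N * τv i true := fun N i =>
    Nat.floor_le (mul_nonneg (Nat.cast_nonneg _) (hτv0 _ _))
  have hK2 : ∀ (N : ℕ) i, (N : ℝ) * τv i true ≤ K N i + 1 := fun N i => (Nat.lt_floor_add_one _).le
  have hKN : ∀ N i, K N i ≤ N + L := by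
    intro N i
    have : (K N i : ℝ) ≤ ((N + L : ℕ) : ℝ) := by
      push_cast
      have h1 : (N : ℝ) * τv i true ≤ N * 1 :=
        mul_le_mul_of_nonneg_left (by linarith [hvt i, hτv0 i false]) (Nat.cast_nonneg _)
      have h2 : (0 : ℝ) ≤ L := Nat.cast_nonneg _
      linarith [hK1 N i]
    exact_mod_cast this
  let x0 : (N : ℕ) → Fin n → Fin (N + L) → Bool := fun N i => seg (N + L) (K N i)
  have hx0c : ∀ N i, cnt (x0 N i) = K N i := fun N i => cnt_seg (hKN N i)
  have hL1' : (1 : ℝ) ≤ L := by exact_mod_cast hL1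
  have hx0 : ∀ i N b, |(typ (x0 N i) b : ℝ) - N * τv i b| ≤ ((2 * L : ℕ) : ℝ) := by
    intro i N b
    push_cast
    cases b
    · rw [typ_false, hx0c, Nat.cast_sub (hKN N i)]
      push_cast
      have e : τv i false = 1 - τv i true := by linarith [hvt i]
      rw [e, abs_le]
      constructor <;> linarith [hK1 N i, hK2 N i]
    · rw [typ_true, hx0c, abs_le]
      constructor <;> linarith [hK1 N i, hK2 N i]
  have hw : ∀ (N : ℕ) (a : 𝒜), ∃ w : Fin (N + L) → { i // i ∈ a.1 } → Bool,
      (∀ i, cnt (fun m => w m i) = K N i.1) ∧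
      ∀ u, |(typ w u : ℝ) - N * τf a.1 u| ≤ 2 * L := by
    intro N a
    refine rounding (τf a.1) (hτf0 a.1 a.2) (hsum1 a) N L ?_ (fun i => K N i.1) ?_
    · rw [Fintype.card_fun, Fintype.card_bool, Fintype.card_coe]
      exact Nat.pow_le_pow_right (by norm_num) ((card_le_univ _).trans (by simp))
    · intro i
      rw [hcons a.1 a.2 i true]
  choose w hwc hwt using hw
  have hwt' : ∀ (a : 𝒜) N u, |(typ (w N a) u : ℝ) - N * τf a.1 u| ≤ ((2 * L : ℕ) : ℝ) := by
    intro a N u; push_cast; exact hwt N a u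
  have hineq : ∀ N : ℕ,
      (∑ i, (Real.log (mult (x0 N i)) / ((N + L : ℕ) : ℝ)
        + ∑ b, (typ (x0 N i) b / ((N + L : ℕ) : ℝ) : ℝ) * Real.log (φ i b))) +
      ∑ a : 𝒜, (Real.log (mult (w N a)) / ((N + L : ℕ) : ℝ)
        - ∑ i : { i // i ∈ a.1 }, Real.log (mult (x0 N i.1)) / ((N + L : ℕ) : ℝ)
        + ∑ u, (typ (w N a) u / ((N + L : ℕ) : ℝ) : ℝ) * Real.log (ψ a.1 u)) ≤ Real.log Z := by
    intro N
    have hMpos : (0 : ℝ) < ((N + L : ℕ) : ℝ) := by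
      have : 0 < N + L := by omega
      exact_mod_cast this
    have hc := cover_bound 𝒜 φ hφ ψ hψpos hψ (x0 N) (w N) (fun a i => by rw [hwc, hx0c])
    have hp1 : ∀ i, 0 < ∏ m, φ i (x0 N i m) := fun i => prod_pos fun m _ => hφ _ _
    have hp2 : ∀ a : 𝒜, 0 < ∏ m, ψ a.1 (w N a m) := fun a => prod_pos fun m _ => hψpos _ a.2 _
    have hp3 : ∀ a : 𝒜, 0 < ∏ i : { i // i ∈ a.1 }, (mult (x0 N i.1))⁻¹ := fun a =>
      prod_pos fun i _ => inv_pos.2 (mult_pos _)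
    have hp4 : ∀ i, 0 < mult (x0 N i) * ∏ m, φ i (x0 N i m) := fun i => mul_pos (mult_pos _) (hp1 i)
    have hp5 : ∀ a : 𝒜, 0 < mult (w N a) * (∏ i : { i // i ∈ a.1 }, (mult (x0 N i.1))⁻¹) *
        ∏ m, ψ a.1 (w N a m) := fun a => mul_pos (mul_pos (mult_pos _) (hp3 a)) (hp2 a)
    have hl := Real.log_le_log (mul_pos (prod_pos fun i _ => hp4 i) (prod_pos fun a _ => hp5 a)) hc
    rw [Real.log_pow, ← hZ, Real.log_mul (prod_pos fun i _ => hp4 i).ne' (prod_pos fun a _ => hp5 a).ne',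
      Real.log_prod (fun i _ => (hp4 i).ne'), Real.log_prod (fun a _ => (hp5 a).ne')] at hl
    have hl2 := (div_le_iff₀' hMpos).2 hl
    refine le_trans (le_of_eq ?_) hl2
    rw [add_div, sum_div, sum_div]
    congr 1
    · refine sum_congr rfl fun i _ => ?_
      rw [Real.log_mul (mult_pos _).ne' (hp1 i).ne', add_div, log_prod_typ (x0 N i) (φ i) (hφ i)]
    · refine sum_congr rfl fun a _ => ?_
      rw [Real.log_mul (mul_pos (mult_pos _) (hp3 a)).ne' (hp2 a).ne',
        Real.log_mul (mult_pos _).ne' (hp3 a).ne', add_div, add_div,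
        log_prod_typ (w N a) (ψ a.1) (hψpos _ a.2),
        Real.log_prod (fun i _ => (inv_pos.2 (mult_pos _)).ne'), sum_div]
      simp only [Real.log_inv, neg_div, sum_neg_distrib]
      ring
  refine le_of_tendsto' (x := (atTop : Filter ℕ)) ?_ hineq
  refine Tendsto.add (tendsto_finsetSum _ fun i _ => Tendsto.add ?_ (tendsto_finsetSum _ fun b _ => ?_))
    (tendsto_finsetSum _ fun a _ => Tendsto.add (Tendsto.sub ?_ (tendsto_finsetSum _ fun i _ => ?_))
      (tendsto_finsetSum _ fun u _ => ?_))
  · exact mult_tendsto L (2 * L) (fun N => x0 N i) (τv i) (hx0 i)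
  · exact (typ_tendsto L (2 * L) (fun N => x0 N i) (τv i) (hx0 i) b).mul_const _
  · exact mult_tendsto L (2 * L) (fun N => w N a) (τf a.1) (hwt' a)
  · exact mult_tendsto L (2 * L) (fun N => x0 N i.1) (τv i.1) (hx0 i.1)
  · exact (typ_tendsto L (2 * L) (fun N => w N a) (τf a.1) (hwt' a) u).mul_const _

end BetheAux


/-- The resolution of the conjecture of Sudderth, Wainwright and Willsky (Corollary 10 of
the paper): if `f : {0,1}ⁿ → ℝ≥0` admits a factorization over `G = (V, 𝒜)` with strictly
positive potentials in which every factor `ψ_α` is log-supermodular, then the Bethe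
partition function lower-bounds the true partition function, i.e. `Z_B(G, τ) ≤ Z(G)`
for every pseudomarginal `τ` in the local marginal polytope (hence `Z_B(G) ≤ Z(G)`). -/
theorem bethe_le_partition {n : ℕ}
    (𝒜 : Finset (Finset (Fin n)))
    (h𝒜 : ∀ α ∈ 𝒜, α.Nonempty)
    (φ : Fin n → Bool → ℝ) (hφ : ∀ i b, 0 < φ i b)
    (ψ : (α : Finset (Fin n)) → ({ i // i ∈ α } → Bool) → ℝ)
    (hψpos : ∀ α ∈ 𝒜, ∀ u : { i // i ∈ α } → Bool, 0 < ψ α u)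
    (hψ : ∀ α ∈ 𝒜, ∀ u v : { i // i ∈ α } → Bool,
      ψ α u * ψ α v ≤ ψ α (u ⊓ v) * ψ α (u ⊔ v))
    (f : (Fin n → Bool) → ℝ)
    (hf : ∀ x : Fin n → Bool,
      f x = (∏ i : Fin n, φ i (x i)) * ∏ α ∈ 𝒜, ψ α (fun i => x i.val))
    -- a point `τ = (τv, τf)` of the local marginal polytope `𝒯`
    (τv : Fin n → Bool → ℝ)
    (τf : (α : Finset (Fin n)) → ({ i // i ∈ α } → Bool) → ℝ)
    (hτv0 : ∀ i b, 0 ≤ τv i b)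
    (hτf0 : ∀ α ∈ 𝒜, ∀ u : { i // i ∈ α } → Bool, 0 ≤ τf α u)
    (hτv1 : ∀ i, ∑ b : Bool, τv i b = 1)
    (hcons : ∀ α ∈ 𝒜, ∀ i : { i // i ∈ α }, ∀ b : Bool,
      ∑ u ∈ Finset.univ.filter (fun u : { i // i ∈ α } → Bool => u i = b), τf α u
        = τv i.val b) :
    Real.exp (
        (∑ i : Fin n, ∑ b : Bool, τv i b * Real.log (φ i b))
        + (∑ α ∈ 𝒜, ∑ u : { i // i ∈ α } → Bool, τf α u * Real.log (ψ α u))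
        - (∑ i : Fin n, ∑ b : Bool, τv i b * Real.log (τv i b))
        - (∑ α ∈ 𝒜, ∑ u : { i // i ∈ α } → Bool,
            τf α u * Real.log (τf α u / ∏ i : { i // i ∈ α }, τv i.val (u i))))
      ≤ ∑ x : Fin n → Bool, f x := by
  have hmain := BetheAux.bethe_log 𝒜 h𝒜 φ hφ ψ hψpos hψ τv τf hτv0 hτf0 hτv1 hcons
  have hZeq : ∑ x : Fin n → Bool, f x =
      ∑ x : Fin n → Bool, (∏ i : Fin n, φ i (x i)) * ∏ a : 𝒜, ψ a.1 (fun i => x i.val) := by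
    refine Finset.sum_congr rfl fun x _ => ?_
    rw [hf, ← Finset.prod_coe_sort 𝒜]
  have hZpos : 0 < ∑ x : Fin n → Bool, (∏ i : Fin n, φ i (x i)) * ∏ a : 𝒜, ψ a.1 (fun i => x i.val) :=
    Finset.sum_pos (fun x _ => mul_pos (Finset.prod_pos fun i _ => hφ _ _)
      (Finset.prod_pos fun a _ => hψpos _ a.2 _)) Finset.univ_nonempty
  rw [hZeq, ← Real.le_log_iff_exp_le hZpos]
  refine le_trans (le_of_eq ?_) hmain
  rw [← Finset.sum_coe_sort 𝒜, ← Finset.sum_coe_sort 𝒜,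
    Finset.sum_congr rfl (fun (a : 𝒜) _ => BetheAux.bethe_conv (τf a.1) (hτf0 a.1 a.2)
      (fun i => τv i.1) (hcons a.1 a.2))]
  simp only [Finset.sum_add_distrib, Finset.sum_sub_distrib, Finset.sum_neg_distrib,
    Real.negMulLog, neg_mul]
  ring
end
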